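/- arXiv:2006.06333 — 5 statements merged into one kernel-verified Lean document; each statement's English description precedes it below -/
import Mathlib

section
/- The induced subdigraph D[V(P)] is either a semicomplete digraph or a semicomplete bipartite digraph, and the induced subdigraph D[V(D)∖V(P)] is either a semicomplete digraph, a semicomplete bipartite digraph, or an empty digraph (a digraph with no arcs). -/
variable {V : Type*}

/-- Two vertices are adjacent in the digraph with arc relation `A`. -/
def DAdj (A : V → V → Prop) (x y : V) : Prop := A x y ∨ A y x

/-- `x 0, x 1, …, x n` is a directed path of length `n` (distinct vertices, consecutive arcs). -/
def IsDipathOn (A : V → V → Prop) (n : ℕ) (x : ℕ → V) : Prop :=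
  (∀ i j, i ≤ n → j ≤ n → x i = x j → i = j) ∧ ∀ i, i < n → A (x i) (x (i + 1))

/-- There is a directed path of length `n` from `u` to `v`. -/
def HasDipath (A : V → V → Prop) (n : ℕ) (u v : V) : Prop :=
  ∃ x : ℕ → V, IsDipathOn A n x ∧ x 0 = u ∧ x n = v

/-- A digraph is `k`-quasi-transitive if the endpoints of every path of length `k` are adjacent. -/
def KQuasiTransitive (A : V → V → Prop) (k : ℕ) : Prop :=
  ∀ x : ℕ → V, IsDipathOn A k x → DAdj A (x 0) (x k)

/-- A digraph is strong if every vertex is reachable from every other vertex. -/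
def StrongD (A : V → V → Prop) : Prop := ∀ u v : V, ∃ n, HasDipath A n u v

/-- The subdigraph induced on `S` is semicomplete. -/
def SemicompleteOn (A : V → V → Prop) (S : Set V) : Prop :=
  ∀ x ∈ S, ∀ y ∈ S, x ≠ y → DAdj A x y

/-- The subdigraph induced on `S` is semicomplete bipartite. -/
def SemicompleteBipartiteOn (A : V → V → Prop) (S : Set V) : Prop :=
  ∃ X Y : Set V, X ∪ Y = S ∧ X ∩ Y = ∅ ∧
    (∀ x ∈ X, ∀ y ∈ X, ¬ DAdj A x y) ∧
    (∀ x ∈ Y, ∀ y ∈ Y, ¬ DAdj A x y) ∧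
    (∀ x ∈ X, ∀ y ∈ Y, DAdj A x y)

/-- The subdigraph induced on `S` has no arcs. -/
def EmptyOn (A : V → V → Prop) (S : Set V) : Prop :=
  ∀ x ∈ S, ∀ y ∈ S, ¬ A x y

/-- The vertex set `{P 0, …, P n}` of a path. -/
def VertsUpTo (n : ℕ) (P : ℕ → V) : Set V := {w | ∃ i ≤ n, P i = w}

/-- The odd-indexed vertices among `{P 0, …, P n}`. -/
def OddVertsUpTo (n : ℕ) (P : ℕ → V) : Set V := {w | ∃ i, i ≤ n ∧ Odd i ∧ P i = w}

/-- The even-indexed vertices among `{P 0, …, P n}`. -/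
def EvenVertsUpTo (n : ℕ) (P : ℕ → V) : Set V := {w | ∃ i, i ≤ n ∧ Even i ∧ P i = w}

/-- `I`: vertices outside `S` receiving no arc from `S`. -/
def ISet (A : V → V → Prop) (S : Set V) : Set V :=
  {x | x ∉ S ∧ ∀ w ∈ S, ¬ A w x}

/-- `W`: vertices outside `S` sending no arc to `S`. -/
def WSet (A : V → V → Prop) (S : Set V) : Set V :=
  {x | x ∉ S ∧ ∀ w ∈ S, ¬ A x w}

/-- `B`: vertices outside `S` that are in neither `I` nor `W`. -/
def BSet (A : V → V → Prop) (S : Set V) : Set V :=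
  {x | x ∉ S ∧ x ∉ ISet A S ∧ x ∉ WSet A S}

/-- There is a directed path of length `n` from `x` to `y` with all its vertices in `S`. -/
def DipathIn (A : V → V → Prop) (S : Set V) (n : ℕ) (x y : V) : Prop :=
  ∃ f : ℕ → V, IsDipathOn A n f ∧ f 0 = x ∧ f n = y ∧ ∀ i ≤ n, f i ∈ S

namespace DipathIn

variable {A : V → V → Prop} {S S' : Set V} {m n : ℕ} {x y z w : V}

lemma single (A : V → V → Prop) (x : V) : DipathIn A {x} 0 x x :=
  ⟨fun _ => x, ⟨fun i j hi hj _ => by omega, fun i hi => by omega⟩, rfl, rfl, fun _ _ => rfl⟩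

lemma append (h : DipathIn A S m x y) (hyz : A y z) (h' : DipathIn A S' n z w)
    (hd : ∀ v ∈ S, v ∉ S') : DipathIn A (S ∪ S') (m + n + 1) x w := by
  obtain ⟨f, ⟨fi, fa⟩, f0, fm, fS⟩ := h
  obtain ⟨g, ⟨gi, ga⟩, g0, gn, gS⟩ := h'
  refine ⟨fun i => if i ≤ m then f i else g (i - (m + 1)), ⟨?_, ?_⟩, ?_, ?_, ?_⟩
  · intro i j hi hj hij
    by_cases h1 : i ≤ m <;> by_cases h2 : j ≤ m <;> simp only [h1, h2, if_true, if_false] at hij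
    · exact fi i j h1 h2 hij
    · exact absurd (hij ▸ gS _ (by omega)) (hd _ (fS i h1))
    · exact absurd (hij ▸ gS (i - (m + 1)) (by omega)) (hd _ (fS j h2))
    · have := gi _ _ (by omega) (by omega) hij
      omega
  · intro i hi
    rcases lt_trichotomy i m with h1 | h1 | h1
    · simpa [h1.le, Nat.succ_le_of_lt h1] using fa i h1
    · subst h1
      simpa [fm, g0] using hyz
    · have h2 : ¬ i ≤ m := by omega
      have h3 : ¬ i + 1 ≤ m := by omega
      simp only [h2, h3, if_false]
      have := ga (i - (m + 1)) (by omega)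
      rwa [show i - (m + 1) + 1 = i + 1 - (m + 1) by omega] at this
  · simpa using f0
  · have h2 : ¬ m + n + 1 ≤ m := by omega
    simp only [h2, if_false]
    rwa [show m + n + 1 - (m + 1) = n by omega]
  · intro i hi
    by_cases h1 : i ≤ m
    · simpa [h1] using Or.inl (fS i h1)
    · simpa [h1] using Or.inr (gS (i - (m + 1)) (by omega))

lemma cons (hxy : A x y) (h : DipathIn A S n y z) (hx : x ∉ S) :
    DipathIn A (insert x S) (n + 1) x z := by
  have := (single A x).append hxy h (by simpa using hx)
  rwa [Nat.zero_add] at this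

lemma concat (h : DipathIn A S n x y) (hyz : A y z) (hz : z ∉ S) :
    DipathIn A (insert z S) (n + 1) x z := by
  have := h.append hyz (single A z) (by rintro v hv rfl; exact hz hv)
  rwa [Set.union_comm] at this

lemma mono (h : DipathIn A S n x y) (hS : S ⊆ S') : DipathIn A S' n x y := by
  obtain ⟨f, h1, h2, h3, h4⟩ := h
  exact ⟨f, h1, h2, h3, fun i hi => hS (h4 i hi)⟩

lemma dAdj {k : ℕ} (hQ : KQuasiTransitive A k) (h : DipathIn A S n x y) (hn : n = k) :
    DAdj A x y := by
  obtain ⟨f, h1, rfl, rfl, _⟩ := h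
  subst hn
  exact hQ f h1

end DipathIn

lemma IsDipathOn.flip {A : V → V → Prop} {n : ℕ} {f : ℕ → V} (h : IsDipathOn A n f) :
    IsDipathOn (flip A) n (fun i => f (n - i)) := by
  refine ⟨fun i j hi hj hij => ?_, fun i hi => ?_⟩
  · have := h.1 _ _ (by omega) (by omega) hij
    omega
  · have := h.2 (n - (i + 1)) (by omega)
    rwa [show n - (i + 1) + 1 = n - i by omega] at this

lemma DAdj.symm {A : V → V → Prop} {x y : V} (h : DAdj A x y) : DAdj A y x := Or.symm h

lemma dAdj_flip {A : V → V → Prop} {x y : V} : DAdj (flip A) x y ↔ DAdj A x y := Or.comm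

lemma KQuasiTransitive.flip {A : V → V → Prop} {k : ℕ} (h : KQuasiTransitive A k) :
    KQuasiTransitive (flip A) k := by
  intro x hx
  have := h _ hx.flip
  simp only [Nat.sub_zero, Nat.sub_self] at this
  exact dAdj_flip.2 this.symm

/-- The properties of a geodesic `P 0, …, P (k + 2)` in a strong `k`-quasi-transitive digraph
that determine the structure around it. They are invariant under reversing all arcs. -/
structure IsLongGeodesic (A : V → V → Prop) (k : ℕ) (P : ℕ → V) : Prop where
  five_le : 5 ≤ k
  odd : k % 2 = 1
  quasiTransitive : KQuasiTransitive A k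
  strong : ∀ x y, Relation.ReflTransGen A x y
  inj : ∀ i j, i ≤ k + 2 → j ≤ k + 2 → P i = P j → i = j
  arc : ∀ i, i < k + 2 → A (P i) (P (i + 1))
  not_skip : ∀ i j, i + 1 < j → j ≤ k + 2 → ¬ A (P i) (P j)
  not_bypass : ∀ i j v, i + 2 < j → j ≤ k + 2 → A (P i) v → ¬ A v (P j)

/-- The vertex `u` has a neighbour `P i` with `i ≡ c` modulo `2`. -/
def HasType (A : V → V → Prop) (k : ℕ) (P : ℕ → V) (u : V) (c : ℕ) : Prop :=
  ∃ i ≤ k + 2, i % 2 = c % 2 ∧ DAdj A u (P i)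

/-- Some arc joins two vertices of the path whose indices have the same parity. -/
def HasEvenArc (A : V → V → Prop) (k : ℕ) (P : ℕ → V) : Prop :=
  ∃ i j, i < j ∧ j ≤ k + 2 ∧ j % 2 = i % 2 ∧ A (P j) (P i)

lemma HasType.congr {A : V → V → Prop} {k : ℕ} {P : ℕ → V} {u : V} {c d : ℕ}
    (h : HasType A k P u c) (hcd : c % 2 = d % 2) : HasType A k P u d := by
  obtain ⟨i, hi, hc, ha⟩ := h
  exact ⟨i, hi, hc.trans hcd, ha⟩

lemma hasType_flip {A : V → V → Prop} {k : ℕ} {P : ℕ → V} {u : V} {c d : ℕ}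
    (hk : k % 2 = 1) (hcd : d % 2 = (c + 1) % 2) :
    HasType (flip A) k (fun i => P (k + 2 - i)) u d ↔ HasType A k P u c := by
  constructor
  · rintro ⟨i, hi, hc, ha⟩
    exact ⟨k + 2 - i, by omega, by omega, dAdj_flip.1 ha⟩
  · rintro ⟨i, hi, hc, ha⟩
    refine ⟨k + 2 - i, by omega, by omega, dAdj_flip.2 ?_⟩
    simpa [show k + 2 - (k + 2 - i) = i by omega] using ha

lemma hasEvenArc_of_flip {A : V → V → Prop} {k : ℕ} {P : ℕ → V}
    (h : HasEvenArc (flip A) k (fun i => P (k + 2 - i))) : HasEvenArc A k P := by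
  obtain ⟨i, j, hij, hj, hp, ha⟩ := h
  exact ⟨k + 2 - j, k + 2 - i, by omega, by omega, by omega, ha⟩

lemma vertsUpTo_flip (n : ℕ) (P : ℕ → V) :
    VertsUpTo n (fun i => P (n - i)) = VertsUpTo n P := by
  ext w
  constructor
  · rintro ⟨i, hi, rfl⟩
    exact ⟨n - i, by omega, rfl⟩
  · rintro ⟨i, hi, rfl⟩
    exact ⟨n - i, by omega, by simp [show n - (n - i) = i by omega]⟩

namespace IsLongGeodesic

variable {A : V → V → Prop} {k : ℕ} {P : ℕ → V}

lemma flip (h : IsLongGeodesic A k P) : IsLongGeodesic (flip A) k (fun i => P (k + 2 - i)) where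
  five_le := h.five_le
  odd := h.odd
  quasiTransitive := h.quasiTransitive.flip
  strong x y := Relation.reflTransGen_swap.2 (h.strong y x)
  inj i j hi hj hij := by
    have := h.inj _ _ (by omega) (by omega) hij
    omega
  arc i hi := by
    have := h.arc (k + 2 - (i + 1)) (by omega)
    rwa [show k + 2 - (i + 1) + 1 = k + 2 - i by omega] at this
  not_skip i j hij hj := h.not_skip _ _ (by omega) (by omega)
  not_bypass i j v hij hj h1 h2 := h.not_bypass _ _ v (by omega) (by omega) h2 h1

/-- A sequence of indices describing a path inside `P 0, …, P (k + 2)`. -/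
lemma dipathIn_range_of_index (h : IsLongGeodesic A k P) {X : ℕ → ℕ → Prop}
    (hX : ∀ a b, X a b → A (P a) (P b)) (n : ℕ) (f : ℕ → ℕ) (hf : ∀ i ≤ n, f i ≤ k + 2)
    (hinj : ∀ i j, i < j → j ≤ n → f i ≠ f j)
    (harc : ∀ i < n, f (i + 1) = f i + 1 ∨ X (f i) (f (i + 1))) :
    DipathIn A {w | ∃ i ≤ n, P (f i) = w} n (P (f 0)) (P (f n)) := by
  refine ⟨fun i => P (f i), ⟨fun i j hi hj hij => ?_, fun i hi => ?_⟩, rfl, rfl,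
    fun i hi => ⟨i, hi, rfl⟩⟩
  · have h1 := h.inj _ _ (hf i hi) (hf j hj) hij
    rcases lt_trichotomy i j with h2 | h2 | h2
    · exact absurd h1 (hinj i j h2 hj)
    · exact h2
    · exact absurd h1.symm (hinj j i h2 hi)
  · rcases harc i hi with h1 | h1
    · simp only [h1]
      exact h.arc _ (by have := hf (i + 1) hi; omega)
    · exact hX _ _ h1

lemma dipathIn_of_index (h : IsLongGeodesic A k P) {X : ℕ → ℕ → Prop}
    (hX : ∀ a b, X a b → A (P a) (P b)) (n : ℕ) (f : ℕ → ℕ) (hf : ∀ i ≤ n, f i ≤ k + 2)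
    (hinj : ∀ i j, i < j → j ≤ n → f i ≠ f j)
    (harc : ∀ i < n, f (i + 1) = f i + 1 ∨ X (f i) (f (i + 1))) :
    DipathIn A (VertsUpTo (k + 2) P) n (P (f 0)) (P (f n)) :=
  (h.dipathIn_range_of_index hX n f hf hinj harc).mono
    (by rintro w ⟨i, hi, rfl⟩; exact ⟨f i, hf i hi, rfl⟩)

/-- A backward path of length `k` in `P 0, …, P (k + 2)` gives a backward arc. -/
lemma back_of_index (h : IsLongGeodesic A k P) {X : ℕ → ℕ → Prop}
    (hX : ∀ a b, X a b → A (P a) (P b)) (f : ℕ → ℕ) (s t : ℕ) (hs : f 0 = s) (ht : f k = t)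
    (hst : t + 1 < s) (hf : ∀ i ≤ k, f i ≤ k + 2)
    (hinj : ∀ i j, i < j → j ≤ k → f i ≠ f j)
    (harc : ∀ i < k, f (i + 1) = f i + 1 ∨ X (f i) (f (i + 1))) : A (P s) (P t) := by
  have h1 := (h.dipathIn_of_index hX k f hf hinj harc).dAdj h.quasiTransitive rfl
  rw [hs, ht] at h1
  rcases h1 with h1 | h1
  · exact h1
  · exact absurd h1 (h.not_skip _ _ hst (by rw [← hs]; exact hf 0 (by omega)))

lemma arc_add_k (h : IsLongGeodesic A k P) (i : ℕ) (hi : i ≤ 2) :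
    A (P (i + k)) (P i) := by
  have h5 := h.five_le
  have h1 := (h.dipathIn_of_index (X := fun _ _ => False) (by simp) k (fun t => i + t)
    (by intros; omega) (by intros; omega) (by intros; left; omega)).dAdj h.quasiTransitive rfl
  rcases h1 with h1 | h1
  · exact absurd h1 (h.not_skip _ _ (by omega) (by omega))
  · simpa using h1

lemma arc_last_zero (h : IsLongGeodesic A k P) : A (P (k + 2)) (P 0) := by
  have h5 := h.five_le
  refine h.back_of_index (X := fun a b => (a = k + 2 ∧ b = 2) ∨ (a = k ∧ b = 0)) ?_
    (fun t => if t = 0 then k + 2 else if t ≤ k - 1 then t + 1 else 0) _ _ ?_ ?_ ?_ ?_ ?_ ?_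
  · rintro a b (⟨rfl, rfl⟩ | ⟨rfl, rfl⟩)
    · simpa [Nat.add_comm] using h.arc_add_k 2 le_rfl
    · simpa using h.arc_add_k 0 (by omega)
  all_goals intros; grind

lemma arc_last_even (h : IsLongGeodesic A k P) (j : ℕ) (hj : j ≤ k - 1) (hj2 : j % 2 = 0) :
    A (P (k + 2)) (P j) := by
  have h5 := h.five_le
  have hk := h.odd
  have key : ∀ m j, j + 2 * m = k - 1 → A (P (k + 2)) (P j) := by
    intro m
    induction m with
    | zero =>
      intro j hj
      refine h.back_of_index (X := fun a b => a = k + 2 ∧ b = 0) ?_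
        (fun t => if t = 0 then k + 2 else t - 1) _ _ ?_ ?_ ?_ ?_ ?_ ?_
      · rintro a b ⟨rfl, rfl⟩
        exact h.arc_last_zero
      all_goals intros; grind
    | succ m ih =>
      intro j hj
      refine h.back_of_index (X := fun a b => (a = k + 2 ∧ b = j + 2) ∨ (a = k ∧ b = 0)) ?_
        (fun t => if t = 0 then k + 2 else if t ≤ k - j - 1 then t + j + 1 else t - (k - j))
        _ _ ?_ ?_ ?_ ?_ ?_ ?_
      · rintro a b (⟨rfl, rfl⟩ | ⟨rfl, rfl⟩)
        · exact ih _ (by omega)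
        · simpa using h.arc_add_k 0 (by omega)
      all_goals intros; grind
  exact key ((k - 1 - j) / 2) j (by omega)

lemma arc_odd_zero (h : IsLongGeodesic A k P) (i : ℕ) (hi3 : 3 ≤ i) (hi : i ≤ k + 2)
    (hi2 : i % 2 = 1) : A (P i) (P 0) := by
  have hk := h.odd
  have := h.flip.arc_last_even (k + 2 - i) (by omega) (by omega)
  simpa [_root_.flip, show k + 2 - (k + 2 - i) = i by omega] using this

lemma arc_penultimate_odd (h : IsLongGeodesic A k P) (j : ℕ) (hj : j ≤ k - 2)
    (hj2 : j % 2 = 1) : A (P (k + 1)) (P j) := by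
  have h5 := h.five_le
  have hk := h.odd
  refine h.back_of_index
    (X := fun a b => (a = k + 2 ∧ b ≤ k - 1 ∧ b % 2 = 0) ∨ (a = k ∧ b = 0)) ?_
    (fun t => if t ≤ 1 then k + 1 + t else if t ≤ k - j - 1 then t + j + 1 else t - (k - j))
    _ _ ?_ ?_ ?_ ?_ ?_ ?_
  · rintro a b (⟨rfl, hb, hb2⟩ | ⟨rfl, rfl⟩)
    · exact h.arc_last_even b hb hb2
    · simpa using h.arc_add_k 0 (by omega)
  all_goals intros; grind

/-- All backward arcs of odd difference at least `3` are present. -/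
lemma arc_back (h : IsLongGeodesic A k P) (i j : ℕ) (hi : i ≤ k + 2) (hji : j + 3 ≤ i)
    (hp : (i - j) % 2 = 1) : A (P i) (P j) := by
  have h5 := h.five_le
  have hk := h.odd
  have even : ∀ i j, i ≤ k + 2 → j + 3 ≤ i → i % 2 = 0 → j % 2 = 1 → A (P i) (P j) := by
    intro i j hi hji hi2 hj2
    rcases Nat.lt_or_ge k i with hki | hki
    · obtain rfl : i = k + 1 := by omega
      exact h.arc_penultimate_odd j (by omega) hj2
    refine h.back_of_index
      (X := fun a b => (a = k + 1 ∧ b ≤ k - 2 ∧ b % 2 = 1) ∨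
        (3 ≤ a ∧ a ≤ k + 2 ∧ a % 2 = 1 ∧ b = 0)) ?_
      (fun t => if t ≤ k + 1 - i then i + t else if t ≤ k - j - 1 then t + i + j - k
        else t - (k - j)) _ _ ?_ ?_ ?_ ?_ ?_ ?_
    · rintro a b (⟨rfl, hb, hb2⟩ | ⟨ha, ha', ha2, rfl⟩)
      · exact h.arc_penultimate_odd b hb hb2
      · exact h.arc_odd_zero a ha ha' ha2
    all_goals intros; grind
  rcases Nat.even_or_odd i with hi2 | hi2
  · rw [Nat.even_iff] at hi2
    exact even i j hi hji hi2 (by omega)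
  rw [Nat.odd_iff] at hi2
  rcases Nat.eq_zero_or_pos j with rfl | hj
  · exact h.arc_odd_zero i (by omega) hi hi2
  rcases Nat.lt_or_ge k i with hki | hki
  · obtain rfl : i = k + 2 := by omega
    exact h.arc_last_even j (by omega) (by omega)
  refine h.back_of_index
    (X := fun a b => (a = k + 2 ∧ b ≤ k - 1 ∧ b % 2 = 0) ∨
      (4 ≤ a ∧ a ≤ k + 2 ∧ a % 2 = 0 ∧ b = 1)) ?_
    (fun t => if t ≤ k + 2 - i then i + t else if t ≤ k - j then t + i + j - k - 1
      else t - (k - j)) _ _ ?_ ?_ ?_ ?_ ?_ ?_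
  · rintro a b (⟨rfl, hb, hb2⟩ | ⟨ha, ha', ha2, rfl⟩)
    · exact h.arc_last_even b hb hb2
    · exact even a 1 ha' ha ha2 rfl
  all_goals intros; grind

/-- A variant of `back_of_index` where the backward arcs of odd difference are available. -/
lemma back_of_index_odd (h : IsLongGeodesic A k P) {X : ℕ → ℕ → Prop}
    (hX : ∀ a b, X a b → A (P a) (P b)) (f : ℕ → ℕ) (s t : ℕ) (hs : f 0 = s) (ht : f k = t)
    (hst : t + 1 < s) (hf : ∀ i ≤ k, f i ≤ k + 2)
    (hinj : ∀ i j, i < j → j ≤ k → f i ≠ f j)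
    (harc : ∀ i < k, f (i + 1) = f i + 1 ∨
      (f (i + 1) + 3 ≤ f i ∧ (f i - f (i + 1)) % 2 = 1) ∨ X (f i) (f (i + 1))) :
    A (P s) (P t) := by
  refine h.back_of_index
    (X := fun a b => (a ≤ k + 2 ∧ b + 3 ≤ a ∧ (a - b) % 2 = 1) ∨ X a b) ?_
    f s t hs ht hst hf hinj ?_
  · rintro a b (⟨h1, h2, h3⟩ | h1)
    · exact h.arc_back a b h1 h2 h3
    · exact hX a b h1
  · intro i hi
    have := hf i hi.le
    have := harc i hi
    tauto

lemma arc_last_sub_two (h : IsLongGeodesic A k P) {j : ℕ} (hj : 2 ≤ j) (hjk : j ≤ k)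
    (ha : A (P (k + 2)) (P j)) : A (P (k + 2)) (P (j - 2)) := by
  have h5 := h.five_le
  have hk := h.odd
  refine h.back_of_index_odd (X := fun a b => a = k + 2 ∧ b = j)
    (by rintro a b ⟨rfl, rfl⟩; exact ha)
    (fun t => if t = 0 then k + 2 else if t ≤ k + 1 - j then t + j - 1 else t - (k + 2 - j))
    _ _ ?_ ?_ ?_ ?_ ?_ ?_
  all_goals intros; grind

lemma arc_last_of_same_parity (h : IsLongGeodesic A k P) {j i : ℕ} (hjk : j ≤ k)
    (ha : A (P (k + 2)) (P j)) (hij : i ≤ j) (hp : i % 2 = j % 2) : A (P (k + 2)) (P i) := by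
  have key : ∀ m i, i + 2 * m = j → A (P (k + 2)) (P i) := by
    intro m
    induction m with
    | zero => intro i hi; rwa [show i = j by omega]
    | succ m ih =>
      intro i hi
      have := h.arc_last_sub_two (by omega) (by omega) (ih (i + 2) (by omega))
      simpa using this
  exact key ((j - i) / 2) i (by omega)

lemma arc_last_one_of_odd (h : IsLongGeodesic A k P) {i j : ℕ} (hij : i < j) (hj : j ≤ k + 2)
    (hi2 : i % 2 = 1) (hj2 : j % 2 = 1) (ha : A (P j) (P i)) : A (P (k + 2)) (P 1) := by
  have h5 := h.five_le
  have hk := h.odd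
  rcases Nat.lt_or_ge k j with hkj | hkj
  · obtain rfl : j = k + 2 := by omega
    exact h.arc_last_of_same_parity (by omega) ha (by omega) hi2.symm
  rcases Nat.lt_or_ge i 3 with hi3 | hi3
  · obtain rfl : i = 1 := by omega
    refine h.back_of_index_odd (X := fun a b => a = j ∧ b = 1)
      (by rintro a b ⟨rfl, rfl⟩; exact ha)
      (fun t => if t = 0 then k + 2 else if t ≤ k - j then t + j else
        if t ≤ k - 1 then t + j + 1 - k else 1)
      _ _ ?_ ?_ ?_ ?_ ?_ ?_
    all_goals intros; grind
  · have : A (P (k + 2)) (P (i - 2)) := by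
      refine h.back_of_index_odd (X := fun a b => a = j ∧ b = i)
        (by rintro a b ⟨rfl, rfl⟩; exact ha)
        (fun t => if t = 0 then k + 2 else if t ≤ k - j then t + j else
          if t ≤ k - i then t + j + i - k else if t = k - i + 1 then i else t - (k - i + 2))
        _ _ ?_ ?_ ?_ ?_ ?_ ?_
      all_goals intros; grind
    exact h.arc_last_of_same_parity (by omega) this (by omega) (by omega)

lemma arc_last_one (h : IsLongGeodesic A k P) (he : HasEvenArc A k P) :
    A (P (k + 2)) (P 1) := by
  have h5 := h.five_le
  have hk := h.odd
  obtain ⟨i, j, hij, hj, hp, ha⟩ := he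
  rcases Nat.mod_two_eq_zero_or_one i with hi2 | hi2
  · have h1 := h.flip.arc_last_one_of_odd (i := k + 2 - j) (j := k + 2 - i) (by omega) (by omega)
      (by omega) (by omega) (by
        simpa [_root_.flip, show k + 2 - (k + 2 - i) = i by omega,
          show k + 2 - (k + 2 - j) = j by omega] using ha)
    have h2 : A (P (k + 1)) (P 0) := by simpa [_root_.flip] using h1
    refine h.back_of_index_odd (X := fun a b => a = k + 1 ∧ b = 0)
      (by rintro a b ⟨rfl, rfl⟩; exact h2)
      (fun t => if t = 0 then k + 2 else if t ≤ k - 2 then t + 3 else t - (k - 1))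
      _ _ ?_ ?_ ?_ ?_ ?_ ?_
    all_goals intros; grind
  · exact h.arc_last_one_of_odd hij hj hi2 (by omega) ha

lemma arc_last_of_evenArc (h : IsLongGeodesic A k P) (he : HasEvenArc A k P) (j : ℕ)
    (hj : j ≤ k) : A (P (k + 2)) (P j) := by
  have h5 := h.five_le
  have hk := h.odd
  have h1 := h.arc_last_one he
  rcases Nat.mod_two_eq_zero_or_one j with hj2 | hj2
  · exact h.arc_last_even j (by omega) hj2
  have h2 : A (P (k + 2)) (P k) := by
    refine h.back_of_index_odd (X := fun a b => a = k + 2 ∧ b = 1)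
      (by rintro a b ⟨rfl, rfl⟩; exact h1)
      (fun t => if t = 0 then k + 2 else t)
      _ _ ?_ ?_ ?_ ?_ ?_ ?_
    all_goals intros; grind
  exact h.arc_last_of_same_parity le_rfl h2 hj (by omega)

lemma hasEvenArc_flip (he : HasEvenArc A k P) :
    HasEvenArc (_root_.flip A) k (fun i => P (k + 2 - i)) := by
  obtain ⟨i, j, hij, hj, hp, ha⟩ := he
  refine ⟨k + 2 - j, k + 2 - i, by omega, by omega, by omega, ?_⟩
  simpa [_root_.flip, show k + 2 - (k + 2 - i) = i by omega,
          show k + 2 - (k + 2 - j) = j by omega] using ha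

/-- If some arc joins path vertices of equal parity, all backward arcs are present. -/
lemma arc_back_of_evenArc (h : IsLongGeodesic A k P) (he : HasEvenArc A k P) (i j : ℕ)
    (hi : i ≤ k + 2) (hji : j + 2 ≤ i) : A (P i) (P j) := by
  have h5 := h.five_le
  have hk := h.odd
  rcases Nat.mod_two_eq_zero_or_one (i - j) with hp | hp
  swap
  · exact h.arc_back i j hi (by omega) hp
  rcases Nat.lt_or_ge (k + 1) i with hki | hki
  · obtain rfl : i = k + 2 := by omega
    exact h.arc_last_of_evenArc he j (by omega)
  have h1 : ∀ a, 2 ≤ a → a ≤ k + 2 → A (P a) (P 0) := by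
    intro a ha hak
    have := h.flip.arc_last_of_evenArc (hasEvenArc_flip he) (k + 2 - a) (by omega)
    simpa [_root_.flip, show k + 2 - (k + 2 - a) = a by omega] using this
  refine h.back_of_index_odd (X := fun a b => (a = k + 2 ∧ b ≤ k) ∨ (2 ≤ a ∧ a ≤ k + 2 ∧ b = 0))
    (by
      rintro a b (⟨rfl, hb⟩ | ⟨ha, ha', rfl⟩)
      · exact h.arc_last_of_evenArc he b hb
      · exact h1 a ha ha')
    (fun t => if i = j + 2 then (if t ≤ k + 1 - i then i + t else t - (k + 2 - i)) else
      if t ≤ k + 2 - i then i + t else if t ≤ k - j - 1 then t + i + j - k else t - (k - j))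
    _ _ ?_ ?_ ?_ ?_ ?_ ?_
  all_goals intros; grind

/-- A path running around the cycle `P 0, …, P (k + 2), P 0`. -/
lemma dipathIn_cycle (h : IsLongGeodesic A k P) (s L : ℕ) (hs : s ≤ k + 2) (hL : L ≤ k + 2) :
    DipathIn A (VertsUpTo (k + 2) P) L (P s)
      (P (if s + L ≤ k + 2 then s + L else s + L - (k + 3))) := by
  have := h.dipathIn_of_index (X := fun a b => a = k + 2 ∧ b = 0)
    (by rintro a b ⟨rfl, rfl⟩; exact h.arc_last_zero) L
    (fun t => if s + t ≤ k + 2 then s + t else s + t - (k + 3))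
    (by intros; grind) (by intros; grind) (by intros; grind)
  simpa [hs] using this

lemma exists_dipathIn_from (h : IsLongGeodesic A k P) (s L : ℕ) (hs : s ≤ k + 2)
    (hL : L ≤ k + 2) :
    ∃ t ≤ k + 2, t % 2 = (s + L) % 2 ∧ DipathIn A (VertsUpTo (k + 2) P) L (P s) (P t) := by
  have hk := h.odd
  exact ⟨_, by grind, by grind, h.dipathIn_cycle s L hs hL⟩

lemma exists_dipathIn_to (h : IsLongGeodesic A k P) (t L : ℕ) (ht : t ≤ k + 2)
    (hL : L ≤ k + 2) :
    ∃ s ≤ k + 2, s % 2 = (t + L) % 2 ∧ DipathIn A (VertsUpTo (k + 2) P) L (P s) (P t) := by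
  have hk := h.odd
  refine ⟨if L ≤ t then t - L else t + (k + 3) - L, by grind, by grind, ?_⟩
  have := h.dipathIn_cycle (if L ≤ t then t - L else t + (k + 3) - L) L (by grind) hL
  rwa [show (if (if L ≤ t then t - L else t + (k + 3) - L) + L ≤ k + 2 then
    (if L ≤ t then t - L else t + (k + 3) - L) + L else
    (if L ≤ t then t - L else t + (k + 3) - L) + L - (k + 3)) = t by grind] at this

lemma mem_verts {i : ℕ} (hi : i ≤ k + 2) : P i ∈ VertsUpTo (k + 2) P := ⟨i, hi, rfl⟩

section Neighbours

variable {u : V}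

/-- A path of length `k - 1` inside the path vertices followed by an arc to `u`. -/
lemma dAdj_of_index (h : IsLongGeodesic A k P) (hu : u ∉ VertsUpTo (k + 2) P)
    {X : ℕ → ℕ → Prop} (hX : ∀ a b, X a b → A (P a) (P b)) (f : ℕ → ℕ) (s y : ℕ)
    (hy : A (P y) u) (hs : f 0 = s) (ht : f (k - 1) = y) (hf : ∀ i ≤ k - 1, f i ≤ k + 2)
    (hinj : ∀ i j, i < j → j ≤ k - 1 → f i ≠ f j)
    (harc : ∀ i < k - 1, f (i + 1) = f i + 1 ∨ X (f i) (f (i + 1))) : DAdj A u (P s) := by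
  have h5 := h.five_le
  have h1 := h.dipathIn_of_index hX (k - 1) f hf hinj harc
  rw [hs, ht] at h1
  exact ((h1.concat hy hu).dAdj h.quasiTransitive (by omega)).symm

lemma dAdj_add_two (h : IsLongGeodesic A k P) (hu : u ∉ VertsUpTo (k + 2) P) {y : ℕ}
    (hy : y + 2 ≤ k + 2) (ha : A (P y) u) : DAdj A u (P (y + 2)) := by
  have h5 := h.five_le
  have hk := h.odd
  refine h.dAdj_of_index hu (X := fun a b => a ≤ k + 2 ∧ b + 3 ≤ a ∧ (a - b) % 2 = 1)
    (fun a b ⟨h1, h2, h3⟩ => h.arc_back a b h1 h2 h3)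
    (fun t => if 2 ≤ y then (if t ≤ k - y then t + y + 2 else t + y + 1 - k) else
      if t ≤ k - y - 2 then t + y + 2 else t + y + 1 - k) _ y ha ?_ ?_ ?_ ?_ ?_
  all_goals intros; grind

lemma dAdj_add_four (h : IsLongGeodesic A k P) (hu : u ∉ VertsUpTo (k + 2) P) {y : ℕ}
    (hy : y + 4 ≤ k + 2) (ha : A (P y) u) : DAdj A u (P (y + 4)) := by
  have h5 := h.five_le
  refine h.dAdj_of_index hu (X := fun a b => a = k + 2 ∧ b = 0)
    (by rintro a b ⟨rfl, rfl⟩; exact h.arc_last_zero)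
    (fun t => if t ≤ k - y - 2 then t + y + 4 else t + y + 1 - k) _ y ha ?_ ?_ ?_ ?_ ?_
  all_goals intros; grind

lemma dAdj_sub (h : IsLongGeodesic A k P) (hu : u ∉ VertsUpTo (k + 2) P) {y : ℕ}
    (hy : y + (k - 1) ≤ k + 2) (ha : A (P (y + (k - 1))) u) : DAdj A u (P y) := by
  refine h.dAdj_of_index hu (X := fun _ _ => False) (by simp)
    (fun t => y + t) _ _ ha ?_ ?_ ?_ ?_ ?_
  all_goals intros; grind

/-- An arc from `P y` to `u` forces adjacency with all later vertices of the same parity. -/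
lemma dAdj_of_ge (h : IsLongGeodesic A k P) (hu : u ∉ VertsUpTo (k + 2) P) {y z : ℕ}
    (ha : A (P y) u) (hyz : y ≤ z) (hz : z ≤ k + 2) (hp : z % 2 = y % 2) : DAdj A u (P z) := by
  have key : ∀ m, y + 2 * m ≤ k + 2 → DAdj A u (P (y + 2 * m)) := by
    intro m
    induction m with
    | zero => intro _; exact Or.inr ha
    | succ m ih =>
      intro hm
      rcases Nat.lt_or_ge m 2 with h2 | h2
      · interval_cases m
        · exact h.dAdj_add_two hu hm ha
        · exact h.dAdj_add_four hu hm ha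
      · rcases ih (by omega) with h3 | h3
        · exact absurd h3 (h.not_bypass _ _ u (by omega) (by omega) ha)
        · exact h.dAdj_add_two hu hm h3
  have := key ((z - y) / 2) (by omega)
  rwa [show y + 2 * ((z - y) / 2) = z by omega] at this

lemma dAdj_of_le (h : IsLongGeodesic A k P) (hu : u ∉ VertsUpTo (k + 2) P) {y z : ℕ}
    (ha : A u (P y)) (hzy : z ≤ y) (hy : y ≤ k + 2) (hp : z % 2 = y % 2) : DAdj A u (P z) := by
  have := h.flip.dAdj_of_ge (u := u) (y := k + 2 - y) (z := k + 2 - z)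
    (by rwa [vertsUpTo_flip])
    (by simpa [_root_.flip, show k + 2 - (k + 2 - y) = y by omega] using ha)
    (by omega) (by omega) (by omega)
  rw [dAdj_flip] at this
  simpa [show k + 2 - (k + 2 - z) = z by omega] using this

lemma dAdj_window_of_in (h : IsLongGeodesic A k P) (hu : u ∉ VertsUpTo (k + 2) P) {y i : ℕ}
    (hy : y ≤ k + 2) (ha : A (P y) u) (hi : i ≤ k + 2) (hp : i % 2 = y % 2)
    (hw : i ≤ 3 ∨ k - 1 ≤ i) : DAdj A u (P i) := by
  have h5 := h.five_le
  have hk := h.odd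
  obtain ⟨c, hc, hcy⟩ : ∃ c ≤ 1, c = y % 2 := ⟨y % 2, by omega, rfl⟩
  have up := fun y z (ha : A (P y) u) => h.dAdj_of_ge (z := z) hu ha
  have down := fun y z (ha : A u (P y)) => h.dAdj_of_le (z := z) hu ha
  have sub := fun y hy' (ha : A (P (y + (k - 1))) u) => h.dAdj_sub (y := y) hu hy' ha
  rcases up y (c + 2 + (k - 1)) ha (by omega) (by omega) (by omega) with h1 | h1
  · exact down _ i h1 (by omega) (by omega) (by omega)
  rcases sub _ (by omega) h1 with h2 | h2
  · rcases down _ c h2 (by omega) (by omega) (by omega) with h3 | h3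
    · have h4 := h.flip.dAdj_sub (u := u) (y := k + 2 - (c + (k - 1))) (by rwa [vertsUpTo_flip])
        (by omega) (by
          simpa [_root_.flip, show k + 2 - (k + 2 - (c + (k - 1)) + (k - 1)) = c by omega] using h3)
      rw [dAdj_flip] at h4
      simp only [show k + 2 - (k + 2 - (c + (k - 1))) = c + (k - 1) by omega] at h4
      have : i = c ∨ i = c + 2 ∨ i = c + (k - 1) ∨ i = c + 2 + (k - 1) := by omega
      rcases this with rfl | rfl | rfl | rfl
      · exact Or.inl h3
      · exact Or.inl h2
      · exact h4
      · exact Or.inr h1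
    · exact up _ i h3 (by omega) hi (by omega)
  · have h3 : DAdj A u (P c) := by
      rcases up _ (c + (k - 1)) h2 (by omega) (by omega) (by omega) with h3 | h3
      · exact down _ c h3 (by omega) (by omega) (by omega)
      · exact sub _ (by omega) h3
    rcases Nat.lt_or_ge i (c + 2) with h4 | h4
    · rwa [show i = c by omega]
    · exact up _ i h2 h4 hi (by omega)

/-- The extreme vertices of a class in which `u` has a neighbour are all neighbours of `u`. -/
lemma dAdj_window (h : IsLongGeodesic A k P) (hu : u ∉ VertsUpTo (k + 2) P) {c i : ℕ}
    (hc : HasType A k P u c) (hi : i ≤ k + 2) (hp : i % 2 = c % 2)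
    (hw : i ≤ 3 ∨ k - 1 ≤ i) : DAdj A u (P i) := by
  have hk := h.odd
  obtain ⟨y, hy, hyc, ha | ha⟩ := hc
  · have := h.flip.dAdj_window_of_in (u := u) (y := k + 2 - y) (i := k + 2 - i)
      (by rwa [vertsUpTo_flip]) (by omega)
      (by simpa [_root_.flip, show k + 2 - (k + 2 - y) = y by omega] using ha)
      (by omega) (by omega) (by omega)
    rw [dAdj_flip] at this
    simpa [show k + 2 - (k + 2 - i) = i by omega] using this
  · exact h.dAdj_window_of_in hu hy ha hi (by omega) hw

lemma arc_to_of_no_in (h : IsLongGeodesic A k P) (hu : u ∉ VertsUpTo (k + 2) P) {c i : ℕ}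
    (hc : HasType A k P u c) (hin : ∀ w ∈ VertsUpTo (k + 2) P, ¬ A w u) (hi : i ≤ k + 2)
    (hp : i % 2 = c % 2) : A u (P i) := by
  have hk := h.odd
  have h1 : DAdj A u (P (k + 1 + c % 2)) := h.dAdj_window hu hc (by omega) (by omega) (by omega)
  have h2 := h1.resolve_right (hin _ (mem_verts (by omega)))
  exact (h.dAdj_of_le hu h2 (by omega) (by omega) (by omega)).resolve_right
    (hin _ (mem_verts hi))

end Neighbours

lemma hasType_of_arc_to (h : IsLongGeodesic A k P) {p u : V} {i : ℕ}
    (hp : p ∉ VertsUpTo (k + 2) P) (hu : u ∉ VertsUpTo (k + 2) P) (hpu : p ≠ u)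
    (ha : A p u) (hi : i ≤ k + 2) (hui : A u (P i)) : HasType A k P p (i + 1) := by
  have h5 := h.five_le
  have hk := h.odd
  obtain ⟨t, ht, htp, hpath⟩ := h.exists_dipathIn_from i (k - 2) hi (by omega)
  exact ⟨t, ht, by omega, ((hpath.cons hui hu).cons ha (by simp [hpu, hp])).dAdj
    h.quasiTransitive (by omega)⟩

lemma hasType_of_arc_from (h : IsLongGeodesic A k P) {p u : V} {i : ℕ}
    (hp : p ∉ VertsUpTo (k + 2) P) (hu : u ∉ VertsUpTo (k + 2) P) (hpu : p ≠ u)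
    (ha : A p u) (hi : i ≤ k + 2) (hip : A (P i) p) : HasType A k P u (i + 1) := by
  have h5 := h.five_le
  have hk := h.odd
  obtain ⟨t, ht, htp, hpath⟩ := h.exists_dipathIn_to i (k - 2) hi (by omega)
  exact ⟨t, ht, by omega, (((hpath.concat hip hp).concat ha (by simp [hpu.symm, hu])).dAdj
    h.quasiTransitive (by omega)).symm⟩

end IsLongGeodesic

/-- `δ` is the distance from the set `S` in the digraph with arc relation `A`. -/
structure IsLevel (A : V → V → Prop) (S : Set V) (δ : V → ℕ) : Prop where
  eq_zero : ∀ y, δ y = 0 ↔ y ∈ S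
  le : ∀ x y, A x y → δ y ≤ δ x + 1
  pred : ∀ y, δ y ≠ 0 → ∃ x, A x y ∧ δ y = δ x + 1

/-- `y` is reached from `S` by a walk with exactly `n` arcs. -/
def ReachIn (A : V → V → Prop) (S : Set V) : ℕ → V → Prop
  | 0, y => y ∈ S
  | n + 1, y => ∃ x, ReachIn A S n x ∧ A x y

lemma exists_isLevel {A : V → V → Prop} {S : Set V} {s : V} (hs : s ∈ S)
    (h : ∀ y, Relation.ReflTransGen A s y) : ∃ δ, IsLevel A S δ := by
  classical
  have hr : ∀ y, ∃ n, ReachIn A S n y := by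
    intro y
    induction h y with
    | refl => exact ⟨0, hs⟩
    | tail _ hbc ih =>
      obtain ⟨n, hn⟩ := ih
      exact ⟨n + 1, _, hn, hbc⟩
  have hle : ∀ x y, A x y → Nat.find (hr y) ≤ Nat.find (hr x) + 1 := fun x y hxy =>
    Nat.find_min' _ ⟨x, Nat.find_spec (hr x), hxy⟩
  refine ⟨fun y => Nat.find (hr y), fun y => Nat.find_eq_zero _, hle, fun y hy => ?_⟩
  obtain ⟨m, hm⟩ := Nat.exists_eq_succ_of_ne_zero hy
  have hspec := Nat.find_spec (hr y)
  rw [hm] at hspec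
  obtain ⟨x, hx, hxy⟩ := hspec
  have h1 := hle x y hxy
  have h2 : Nat.find (hr x) ≤ m := Nat.find_min' _ hx
  exact ⟨x, hxy, by omega⟩

namespace IsLongGeodesic

variable {A : V → V → Prop} {k : ℕ} {P : ℕ → V}

section Level

variable {δ : V → ℕ}

lemma arc_to_of_two_le_level (h : IsLongGeodesic A k P) (hδ : IsLevel A (VertsUpTo (k + 2) P) δ)
    {u : V} (hu : 2 ≤ δ u) {c i : ℕ} (hc : HasType A k P u c) (hi : i ≤ k + 2)
    (hp : i % 2 = c % 2) : A u (P i) := by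
  refine h.arc_to_of_no_in (fun hm => ?_) hc (fun w hw ha => ?_) hi hp
  · have := (hδ.eq_zero u).2 hm
    omega
  · have h1 := (hδ.eq_zero w).2 hw
    have h2 := hδ.le w u ha
    omega

/-- Follow predecessors down the levels; the parities of the neighbours alternate. -/
lemma exists_descent (h : IsLongGeodesic A k P) (hδ : IsLevel A (VertsUpTo (k + 2) P) δ)
    (u : V) (L : ℕ) (hL : L < δ u) :
    ∃ v S, δ v = δ u - L ∧ DipathIn A S L v u ∧
      (∀ x ∈ S, δ v ≤ δ x ∧ δ x ≤ δ u ∧ (δ x = δ u → x = u)) ∧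
      ∀ c, HasType A k P u c → HasType A k P v (c + L) := by
  induction L with
  | zero => exact ⟨u, {u}, rfl, DipathIn.single A u, by simp, fun c hc => hc⟩
  | succ L ih =>
    obtain ⟨v, S, hv, hpath, hS, htype⟩ := ih (by omega)
    obtain ⟨p, hpv, hp⟩ := hδ.pred v (by omega)
    refine ⟨p, insert p S, by omega,
      hpath.cons hpv (fun hm => by have := hS p hm; omega), ?_, fun c hc => ?_⟩
    · rintro x (rfl | hx)
      · exact ⟨le_rfl, by omega, by omega⟩
      · have := hS x hx
        exact ⟨by omega, this.2.1, this.2.2⟩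
    · have hvc := htype c hc
      have h1 := h.arc_to_of_two_le_level hδ (by omega) hvc
        (i := (c + L) % 2) (by omega) (by omega)
      have := h.hasType_of_arc_to (p := p) (u := v)
        (fun hm => by have := (hδ.eq_zero p).2 hm; omega)
        (fun hm => by have := (hδ.eq_zero v).2 hm; omega)
        (fun hm => by rw [hm] at hp; omega) hpv (i := (c + L) % 2) (by omega) h1
      exact this.congr (by omega)

lemma exists_hasType_of_isLevel (h : IsLongGeodesic A k P)
    (hδ : IsLevel A (VertsUpTo (k + 2) P) δ) (u : V) (hu : δ u ≠ 0) :
    ∃ c, HasType A k P u c := by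
  have h5 := h.five_le
  have hk := h.odd
  induction hm : δ u using Nat.strong_induction_on generalizing u with
  | _ m ih =>
  have hdisj : ∀ x, δ x ≠ 0 → x ∉ VertsUpTo (k + 2) P := fun x hx hm => hx ((hδ.eq_zero x).2 hm)
  rcases Nat.lt_or_ge k m with hkm | hkm
  · obtain ⟨v, S, hv, hpath, hS, -⟩ := h.exists_descent hδ u (k - 1) (by omega)
    obtain ⟨p, hpv, hp⟩ := hδ.pred v (by omega)
    have h1 := (hpath.cons hpv (fun hm => by have := hS p hm; omega)).dAdj h.quasiTransitive
      (by omega)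
    have hup : A u p := h1.resolve_left (fun ha => by have := hδ.le _ _ ha; omega)
    obtain ⟨c, hc⟩ := ih (δ v) (by omega) v (by omega) rfl
    have h2 := h.arc_to_of_two_le_level hδ (by omega) hc (i := c % 2) (by omega) (by omega)
    obtain ⟨t, ht, -, hpt⟩ := h.exists_dipathIn_from (c % 2) (k - 3) (by omega) (by omega)
    have hne : ∀ x y, δ x ≠ δ y → x ≠ y := fun x y hxy he => hxy (by rw [he])
    have h3 := ((hpt.cons h2 (hdisj v (by omega))).cons hpv
      (by simp [hne p v (by omega), hdisj p (by omega)])).cons hup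
      (by simp [hne u p (by omega), hne u v (by omega), hdisj u (by omega)])
    exact ⟨t, t, ht, rfl, h3.dAdj h.quasiTransitive (by omega)⟩
  · obtain ⟨v, S, hv, hpath, hS, -⟩ := h.exists_descent hδ u (m - 1) (by omega)
    obtain ⟨p, hpv, hp⟩ := hδ.pred v (by omega)
    obtain ⟨i, hi, rfl⟩ := (hδ.eq_zero p).1 (by omega)
    obtain ⟨s, hs, -, hps⟩ := h.exists_dipathIn_to i (k - m) hi (by omega)
    have h3 := hps.append hpv hpath (fun x hx hxS => by
      have := (hδ.eq_zero x).2 hx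
      have := hS x hxS
      omega)
    exact ⟨s, s, hs, rfl, (h3.dAdj h.quasiTransitive (by omega)).symm⟩

end Level

lemma exists_isLevel (h : IsLongGeodesic A k P) : ∃ δ, IsLevel A (VertsUpTo (k + 2) P) δ :=
  _root_.exists_isLevel (mem_verts (i := 0) (by omega)) (h.strong _)

/-- Every vertex outside the path is adjacent to the path. -/
lemma exists_hasType (h : IsLongGeodesic A k P) {u : V} (hu : u ∉ VertsUpTo (k + 2) P) :
    ∃ c, HasType A k P u c := by
  obtain ⟨δ, hδ⟩ := h.exists_isLevel
  exact h.exists_hasType_of_isLevel hδ u (fun h0 => hu ((hδ.eq_zero u).1 h0))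

lemma hasType_succ_of_in (h : IsLongGeodesic A k P) (he : HasEvenArc A k P) {u : V}
    (hu : u ∉ VertsUpTo (k + 2) P) {y : ℕ} (hy : y ≤ k + 2) (ha : A (P y) u) :
    HasType A k P u (y + 1) := by
  have h5 := h.five_le
  have hk := h.odd
  have hX : ∀ a b, a ≤ k + 2 ∧ b + 2 ≤ a → A (P a) (P b) := fun a b hab =>
    h.arc_back_of_evenArc he a b hab.1 hab.2
  have small : ∀ y, y ≤ k + 1 → A (P y) u → HasType A k P u (y + 1) := by
    intro y hy ha
    refine ⟨y + 1, by omega, rfl, h.dAdj_of_index hu hX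
      (fun t => if 3 ≤ y then (if t ≤ k + 1 - y then t + y + 1 else t + y + 1 - k) else
        if t ≤ k - 2 - y then t + y + 1 else t + y + 1 - k) _ y ha ?_ ?_ ?_ ?_ ?_⟩
    all_goals intros; grind
  rcases Nat.lt_or_ge (k + 1) y with h1 | h1
  · obtain rfl : y = k + 2 := by omega
    rcases h.dAdj_sub hu (y := 3) (by omega) (by rwa [show 3 + (k - 1) = k + 2 by omega])
      with h2 | h2
    · have h3 := h.dipathIn_of_index hX (k - 1) (fun t => if t ≤ k - 2 then t + 3 else 2)
        (by intros; grind) (by intros; grind) (by intros; grind)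
      have h4 := (h3.cons (x := u) (by simpa using h2) hu).dAdj h.quasiTransitive (by omega)
      refine ⟨_, ?_, ?_, h4⟩ <;> grind
    · exact (small 3 (by omega) h2).congr (by omega)
  · exact small y h1 ha

/-- If all backward arcs are present, outside vertices have neighbours of both parities. -/
lemma hasType_of_evenArc (h : IsLongGeodesic A k P) (he : HasEvenArc A k P) {u : V}
    (hu : u ∉ VertsUpTo (k + 2) P) (c : ℕ) : HasType A k P u c := by
  have hk := h.odd
  have key : ∀ y, y ≤ k + 2 → DAdj A u (P y) → HasType A k P u (y + 1) := by
    rintro y hy (ha | ha)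
    · rw [← hasType_flip hk (d := k + 2 - y + 1) (by omega)]
      refine h.flip.hasType_succ_of_in (hasEvenArc_flip he) (by rwa [vertsUpTo_flip])
        (by omega) ?_
      simpa [_root_.flip, show k + 2 - (k + 2 - y) = y by omega] using ha
    · exact h.hasType_succ_of_in he hu hy ha
  obtain ⟨d, y, hy, hyd, ha⟩ := h.exists_hasType hu
  rcases Nat.mod_two_eq_zero_or_one (y + c) with h1 | h1
  · exact ⟨y, hy, by omega, ha⟩
  · exact (key y hy ha).congr (by omega)

lemma hasEvenArc_of_dAdj (h : IsLongGeodesic A k P) {i j : ℕ} (hi : i ≤ k + 2) (hj : j ≤ k + 2)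
    (hij : i ≠ j) (hp : i % 2 = j % 2) (ha : DAdj A (P i) (P j)) : HasEvenArc A k P := by
  rcases Nat.lt_or_gt_of_ne hij with h1 | h1 <;> rcases ha with ha | ha
  · exact absurd ha (h.not_skip _ _ (by omega) hj)
  · exact ⟨i, j, h1, hj, hp.symm, ha⟩
  · exact ⟨j, i, h1, hi, hp, ha⟩
  · exact absurd ha (h.not_skip _ _ (by omega) hi)

/-- A short excursion leaving the path at `P i` and returning at `P j`, where `j` is slightly
ahead of `i` on the cycle, produces an arc between path vertices of equal parity. -/
lemma hasEvenArc_of_detour (h : IsLongGeodesic A k P) {i j m r : ℕ} {S : Set V} {x y : V}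
    (hpath : DipathIn A S m x y) (hS : ∀ w ∈ S, w ∉ VertsUpTo (k + 2) P) (hi : i ≤ k + 2)
    (hj : j ≤ k + 2) (hix : A (P i) x) (hyj : A y (P j)) (hm : m + 2 ≤ k) (hr : 1 ≤ r)
    (hrm : r ≤ m + 4) (hp : (r + m) % 2 = 1) (hij : j = i + r ∨ j + (k + 3) = i + r) :
    HasEvenArc A k P := by
  have hk := h.odd
  have h1 := h.dipathIn_range_of_index (X := fun a b => a = k + 2 ∧ b = 0)
    (by rintro a b ⟨rfl, rfl⟩; exact h.arc_last_zero) (k - 2 - m)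
    (fun t => if j + t ≤ k + 2 then j + t else j + t - (k + 3))
    (by intros; grind) (by intros; grind) (by intros; grind)
  simp only [Nat.add_zero, if_pos hj] at h1
  have h2 := hpath.append hyj h1 (by
    rintro v hv ⟨t, ht, rfl⟩
    exact hS _ hv (mem_verts (by grind)))
  have h3 := h2.cons hix (by
    rintro (h3 | ⟨t, ht, h3⟩)
    · exact hS _ h3 (mem_verts hi)
    · have := h.inj _ _ (by grind) hi h3
      grind)
  refine h.hasEvenArc_of_dAdj hi ?_ ?_ ?_ (h3.dAdj h.quasiTransitive (by omega))
  all_goals grind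

lemma hasEvenArc_of_in_out (h : IsLongGeodesic A k P) {u : V} (hu : u ∉ VertsUpTo (k + 2) P)
    (htype : ∀ c, HasType A k P u c) {a b : ℕ} (ha : a ≤ k + 2) (hb : b ≤ k + 2)
    (hau : A (P a) u) (hub : A u (P b)) : HasEvenArc A k P := by
  have h5 := h.five_le
  have hk := h.odd
  by_contra hne
  have bad : ∀ i j r, i ≤ k + 2 → j ≤ k + 2 → (r = 1 ∨ r = 3) →
      (j = i + r ∨ j + (k + 3) = i + r) → A (P i) u → ¬ A u (P j) := by
    intro i j r hi hj hr hij hiu huj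
    exact hne (h.hasEvenArc_of_detour (DipathIn.single A u) (by simpa using hu) hi hj hiu huj
      (by omega) (r := r) (by omega) (by omega) (by omega) hij)
  have win : ∀ i, i ≤ k + 2 → (i ≤ 3 ∨ k - 1 ≤ i) → DAdj A u (P i) := fun i hi hw =>
    h.dAdj_window hu (htype i) hi rfl hw
  have byp := fun i j => h.not_bypass i j u
  have o02 : A u (P 0) ∨ A u (P 2) := by
    by_contra hno
    rw [not_or] at hno
    have h0 := (win 0 (by omega) (by omega)).resolve_left hno.1
    have h1 := bad 0 1 1 (by omega) (by omega) (by omega) (by omega) h0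
    rcases Nat.lt_or_ge 2 b with h2 | h2
    · exact byp 0 b (by omega) hb h0 hub
    · interval_cases b <;> tauto
  have i02 : A (P k) u ∨ A (P (k + 2)) u := by
    by_contra hno
    rw [not_or] at hno
    have h0 := (win (k + 2) (by omega) (by omega)).resolve_right hno.2
    have h1 := fun h1 => bad (k + 1) (k + 2) 1 (by omega) (by omega) (by omega) (by omega) h1 h0
    rcases Nat.lt_or_ge a k with h2 | h2
    · exact byp a (k + 2) (by omega) (by omega) hau h0
    · obtain rfl | rfl | rfl : a = k ∨ a = k + 1 ∨ a = k + 2 := by omega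
      all_goals tauto
  have b1 := bad k 0 3 (by omega) (by omega) (by omega) (by omega)
  have b2 := bad (k + 2) 0 1 (by omega) (by omega) (by omega) (by omega)
  have b3 := bad (k + 2) 2 3 (by omega) (by omega) (by omega) (by omega)
  have b4 := byp 0 (k + 2) (by omega) (by omega)
  have w0 := win 0 (by omega) (by omega)
  have w2 := win (k + 2) (by omega) (by omega)
  unfold DAdj at w0 w2
  tauto

lemma hasEvenArc_of_no_in (h : IsLongGeodesic A k P) {u : V} (hu : u ∉ VertsUpTo (k + 2) P)
    (htype : ∀ c, HasType A k P u c) (hin : ∀ w ∈ VertsUpTo (k + 2) P, ¬ A w u) :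
    HasEvenArc A k P := by
  have h5 := h.five_le
  obtain ⟨δ, hδ⟩ := h.exists_isLevel
  have hne : ∀ x, δ x ≠ 0 → x ∉ VertsUpTo (k + 2) P := fun x hx hm => hx ((hδ.eq_zero x).2 hm)
  have h0 : δ u ≠ 0 := fun h0 => hu ((hδ.eq_zero u).1 h0)
  obtain ⟨p, hpu, hp⟩ := hδ.pred u h0
  have h1 : δ p ≠ 0 := fun h1 => hin p ((hδ.eq_zero p).1 h1) hpu
  obtain ⟨v, S, hv, -, -, hvt⟩ := h.exists_descent hδ u (δ u - 2) (by omega)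
  obtain ⟨q, hqv, hq⟩ := hδ.pred v (by omega)
  obtain ⟨z, hzq, hz⟩ := hδ.pred q (by omega)
  obtain ⟨i, hi, rfl⟩ := (hδ.eq_zero z).1 (by omega)
  have hout : ∀ j ≤ k + 2, A v (P j) := fun j hj =>
    h.arc_to_of_two_le_level hδ (by omega) (hvt (j + (δ u - 2)) (htype _)) hj (by omega)
  have hqv' : q ∉ ({v} : Set V) := by
    rintro rfl
    omega
  have hpath := (DipathIn.single A v).cons hqv hqv'
  have hS : ∀ w ∈ insert q ({v} : Set V), w ∉ VertsUpTo (k + 2) P := by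
    rintro w (rfl | rfl)
    · exact hne _ (by omega)
    · exact hne _ (by omega)
  rcases Nat.lt_or_ge k i with h2 | h2
  · exact h.hasEvenArc_of_detour hpath hS hi (j := i - (k + 1)) (by omega) hzq
      (hout _ (by omega)) (by omega) (r := 2) (by omega) (by omega) rfl (by omega)
  · exact h.hasEvenArc_of_detour hpath hS hi (j := i + 2) (by omega) hzq
      (hout _ (by omega)) (by omega) (r := 2) (by omega) (by omega) rfl (by omega)

/-- A vertex outside the path with neighbours of both parities forces an arc between path
vertices of equal parity. -/
lemma hasEvenArc_of_hasType (h : IsLongGeodesic A k P) {u : V} (hu : u ∉ VertsUpTo (k + 2) P)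
    (htype : ∀ c, HasType A k P u c) : HasEvenArc A k P := by
  by_cases hin : ∀ w ∈ VertsUpTo (k + 2) P, ¬ A w u
  · exact h.hasEvenArc_of_no_in hu htype hin
  by_cases hout : ∀ w ∈ VertsUpTo (k + 2) P, ¬ A u w
  · refine hasEvenArc_of_flip (h.flip.hasEvenArc_of_no_in (u := u) (by rwa [vertsUpTo_flip]) ?_ ?_)
    · intro c
      exact (hasType_flip h.odd (c := c + 1) (by omega)).2 (htype _)
    · rwa [vertsUpTo_flip]
  push Not at hin hout
  obtain ⟨_, ⟨a, ha, rfl⟩, hau⟩ := hin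
  obtain ⟨_, ⟨b, hb, rfl⟩, hub⟩ := hout
  exact h.hasEvenArc_of_in_out hu htype ha hb hau hub

/-- If no outside vertex has neighbours of both parities, an arc between outside vertices joins
vertices of different types. -/
lemma not_arc_of_hasType (h : IsLongGeodesic A k P)
    (hex : ∀ x ∉ VertsUpTo (k + 2) P, ∀ c, HasType A k P x c → ¬ HasType A k P x (c + 1))
    {u w : V} (hu : u ∉ VertsUpTo (k + 2) P) (hw : w ∉ VertsUpTo (k + 2) P) (huw : u ≠ w)
    {c : ℕ} (hcu : HasType A k P u c) (hcw : HasType A k P w c) : ¬ A u w := by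
  have h5 := h.five_le
  have hk := h.odd
  obtain ⟨δ, hδ⟩ := h.exists_isLevel
  have hne : ∀ x, δ x ≠ 0 → x ∉ VertsUpTo (k + 2) P := fun x hx hm => hx ((hδ.eq_zero x).2 hm)
  have hpar : ∀ x ∉ VertsUpTo (k + 2) P, ∀ d e, HasType A k P x d → HasType A k P x e →
      d % 2 = e % 2 := by
    intro x hx d e hd he
    by_contra hde
    exact hex x hx d hd (he.congr (by omega))
  induction hl : δ u using Nat.strong_induction_on generalizing u with
  | _ l ih =>
  intro ha
  have hwout : ∀ i ≤ k + 2, ¬ A w (P i) := by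
    intro i hi hwi
    have := hpar u hu _ _ hcu (h.hasType_of_arc_to hu hw huw ha hi hwi)
    have := hpar w hw _ _ hcw ⟨i, hi, rfl, Or.inl hwi⟩
    omega
  have huin : ∀ i ≤ k + 2, ¬ A (P i) u := by
    intro i hi hiu
    have := hpar w hw _ _ hcw (h.hasType_of_arc_from hu hw huw ha hi hiu)
    have := hpar u hu _ _ hcu ⟨i, hi, rfl, Or.inr hiu⟩
    omega
  have hl2 : 2 ≤ l := by
    have h0 : δ u ≠ 0 := fun h0 => hu ((hδ.eq_zero u).1 h0)
    obtain ⟨p, hpu, hp⟩ := hδ.pred u h0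
    by_contra hlt
    obtain ⟨i, hi, rfl⟩ := (hδ.eq_zero p).1 (by omega)
    exact huin i hi hpu
  obtain ⟨i, hi, hic, hiw⟩ := hcw
  have hiw := hiw.resolve_left (hwout i hi)
  have hw1 : δ w = 1 := by
    have h0 : δ w ≠ 0 := fun h0 => hw ((hδ.eq_zero w).1 h0)
    have := hδ.le _ _ hiw
    have := (hδ.eq_zero _).2 (mem_verts (P := P) hi)
    omega
  have hno : ∀ x, 2 ≤ δ x → ¬ A w x := by
    intro x hx hwx
    have hxw : w ≠ x := by rintro rfl; omega
    have hxO := hne x (by omega)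
    have hxc := h.hasType_of_arc_from hw hxO hxw hwx hi hiw
    rcases eq_or_ne u x with rfl | hux
    · have := hpar u hu _ _ hcu hxc
      omega
    have h1 := h.arc_to_of_two_le_level hδ hx hxc (i := (i + 1) % 2) (by omega) (by omega)
    obtain ⟨t, ht, htp, hpt⟩ := h.exists_dipathIn_from ((i + 1) % 2) (k - 3) (by omega) (by omega)
    have h3 := ((hpt.cons h1 hxO).cons hwx (by simp [hxw, hw])).cons ha
      (by simp [huw, hux, hu])
    have := hpar u hu _ _ hcu ⟨t, ht, rfl, h3.dAdj h.quasiTransitive (by omega)⟩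
    omega
  obtain ⟨v, S, hv, hpath, hS, hvt⟩ := h.exists_descent hδ u (min l k - 2) (by omega)
  have hvt := hvt c hcu
  obtain ⟨p, hpv, hp⟩ := hδ.pred v (by omega)
  have hpw : p ≠ w := by
    rintro rfl
    exact hno v (by omega) hpv
  have hpO := hne p (by omega)
  have hpc : HasType A k P p (c + (min l k - 2) + 1) :=
    (h.hasType_of_arc_to hpO (hne v (by omega)) (by rintro rfl; omega) hpv
      (i := (c + (min l k - 2)) % 2) (by omega)
      (h.arc_to_of_two_le_level hδ (by omega) hvt (by omega) (by omega))).congr (by omega)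
  have hwS : w ∉ insert p S := by
    rintro (h1 | h1)
    · exact hpw h1.symm
    · have := hS w h1
      omega
  have hpw' := (hpath.cons hpv (fun hm => by have := hS p hm; omega)).concat ha hwS
  rcases Nat.lt_or_ge l k with hlk | hlk
  · obtain ⟨z, hzp, hz⟩ := hδ.pred p (by omega)
    obtain ⟨j, hj, rfl⟩ := (hδ.eq_zero z).1 (by omega)
    have hjp := hpar p hpO _ _ hpc ⟨j, hj, rfl, Or.inr hzp⟩
    obtain ⟨s, hs, hsp, hps⟩ := h.exists_dipathIn_to j (k - 1 - l) hj (by omega)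
    have h3 := hps.append hzp hpw' (by
      rintro x hx (rfl | rfl | hxS)
      · exact hw hx
      · exact hpO hx
      · have := (hδ.eq_zero x).2 hx
        have := hS x hxS
        omega)
    have := hpar w hw _ _ ⟨i, hi, hic, Or.inr hiw⟩
      ⟨s, hs, rfl, (h3.dAdj h.quasiTransitive (by omega)).symm⟩
    omega
  · rcases hpw'.dAdj h.quasiTransitive (by omega) with h1 | h1
    · exact ih (δ p) (by omega) hpO hpw (hpc.congr (by omega)) rfl h1
    · have := hpar p hpO _ _ hpc (h.hasType_of_arc_from hw hpO hpw.symm h1 hi hiw)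
      omega

/-- Either every outside vertex has neighbours of both parities, or none has. -/
def UniformTypes (A : V → V → Prop) (k : ℕ) (P : ℕ → V) : Prop :=
  (∀ x ∉ VertsUpTo (k + 2) P, ∀ c, HasType A k P x c) ∨
    ∀ x ∉ VertsUpTo (k + 2) P, ∀ c, HasType A k P x c → ¬ HasType A k P x (c + 1)

lemma uniformTypes_flip (hk : k % 2 = 1) (hG : UniformTypes A k P) :
    UniformTypes (_root_.flip A) k (fun i => P (k + 2 - i)) := by
  unfold UniformTypes
  rw [vertsUpTo_flip]
  refine hG.imp (fun hG x hx c => ?_) (fun hG x hx c h1 h2 => ?_)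
  · exact (hasType_flip hk (c := c + 1) (by omega)).2 (hG x hx _)
  · exact hG x hx (c + 1) ((hasType_flip hk (by omega)).1 h1) ((hasType_flip hk (by omega)).1 h2)

lemma dAdj_of_level (h : IsLongGeodesic A k P) (hG : UniformTypes A k P) {δ : V → ℕ}
    (hδ : IsLevel A (VertsUpTo (k + 2) P) δ) {w u : V} (hw : 2 ≤ δ w) (hu : δ u ≠ 0)
    (hle : δ u ≤ δ w) (hwu : w ≠ u) {c : ℕ} (hcw : HasType A k P w c)
    (hcu : HasType A k P u (c + 1)) : DAdj A w u := by
  have h5 := h.five_le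
  have hk := h.odd
  have hne : ∀ x, δ x ≠ 0 → x ∉ VertsUpTo (k + 2) P := fun x hx hm => hx ((hδ.eq_zero x).2 hm)
  induction hl : δ u using Nat.strong_induction_on generalizing u with
  | _ l ih =>
  obtain ⟨v, S, hv, hpath, hS, hvt⟩ := h.exists_descent hδ u (min l k - 1) (by omega)
  have hvt := hvt _ hcu
  have hwS : w ∉ S := by
    intro hm
    have := hS w hm
    exact hwu (this.2.2 (by omega))
  rcases Nat.lt_or_ge l k with hlk | hlk
  · obtain ⟨z, hzv, hz⟩ := hδ.pred v (by omega)
    obtain ⟨y, hy, rfl⟩ := (hδ.eq_zero z).1 (by omega)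
    obtain ⟨s, hs, hsp, hps⟩ := h.exists_dipathIn_to y (k - l - 1) hy (by omega)
    have hws : A w (P s) := by
      rcases hG with hG | hG
      · exact h.arc_to_of_two_le_level hδ hw (hG w (hne w (by omega)) s) hs rfl
      · refine h.arc_to_of_two_le_level hδ hw hcw hs ?_
        have h1 : ¬ y % 2 = (c + 1 + (min l k - 1) + 1) % 2 := fun h1 =>
          hG v (hne v (by omega)) _ hvt ⟨y, hy, h1, Or.inr hzv⟩
        omega
    have h3 := (hps.append hzv hpath (fun x hx hxS => by
      have := (hδ.eq_zero x).2 hx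
      have := hS x hxS
      omega)).cons hws (by
        rintro (h1 | h1)
        · exact hne w (by omega) h1
        · exact hwS h1)
    exact h3.dAdj h.quasiTransitive (by omega)
  · have h1 := ih (δ v) (by omega) (u := v) (by omega) (by omega) (by rintro rfl; omega)
      (hvt.congr (by omega)) rfl
    have hwv : A w v := h1.resolve_right (fun ha => by have := hδ.le _ _ ha; omega)
    exact (hpath.cons hwv hwS).dAdj h.quasiTransitive (by omega)

lemma dAdj_of_no_in (h : IsLongGeodesic A k P) (hG : UniformTypes A k P) {w u : V}
    (hw : w ∉ VertsUpTo (k + 2) P) (hu : u ∉ VertsUpTo (k + 2) P) (hwu : w ≠ u) {c : ℕ}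
    (hcw : HasType A k P w c) (hcu : HasType A k P u (c + 1))
    (hin : ∀ x ∈ VertsUpTo (k + 2) P, ¬ A x w) : DAdj A w u := by
  obtain ⟨δ, hδ⟩ := h.exists_isLevel
  have hw0 : δ w ≠ 0 := fun h0 => hw ((hδ.eq_zero w).1 h0)
  have hu0 : δ u ≠ 0 := fun h0 => hu ((hδ.eq_zero u).1 h0)
  have hw2 : 2 ≤ δ w := by
    obtain ⟨p, hpw, hp⟩ := hδ.pred w hw0
    have : δ p ≠ 0 := fun h1 => hin p ((hδ.eq_zero p).1 h1) hpw
    omega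
  rcases Nat.le_total (δ u) (δ w) with hle | hle
  · exact h.dAdj_of_level hG hδ hw2 hu0 hle hwu hcw hcu
  · exact (h.dAdj_of_level hG hδ (by omega) hw0 hle hwu.symm hcu
      (hcw.congr (by omega))).symm

section Mixed

variable {w u : V}

lemma dAdj_of_out_in (h : IsLongGeodesic A k P) (hw : w ∉ VertsUpTo (k + 2) P)
    (hu : u ∉ VertsUpTo (k + 2) P) (hwu : w ≠ u) {i j : ℕ} (hj : j ≤ k + 2)
    (hij : j + 2 = i + k) (hwi : A w (P i)) (hju : A (P j) u) : DAdj A w u := by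
  have h5 := h.five_le
  have h1 := h.dipathIn_cycle i (k - 2) (by omega) (by omega)
  rw [if_pos (by omega), show i + (k - 2) = j by omega] at h1
  exact ((h1.concat hju hu).cons hwi (by simp [hwu, hw])).dAdj h.quasiTransitive (by omega)

lemma dAdj_of_single_types (h : IsLongGeodesic A k P)
    (hex : ∀ x ∉ VertsUpTo (k + 2) P, ∀ c, HasType A k P x c → ¬ HasType A k P x (c + 1))
    (hw : w ∉ VertsUpTo (k + 2) P) (hu : u ∉ VertsUpTo (k + 2) P) (hwu : w ≠ u)
    (hcw : HasType A k P w 0) (hcu : HasType A k P u 1)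
    {a b : ℕ} (ha : a ≤ k + 2) (haw : A (P a) w) (hb : b ≤ k + 2) (hub : A u (P b)) :
    DAdj A w u := by
  have h5 := h.five_le
  have hk := h.odd
  by_contra hno
  have ha2 : a % 2 = 0 := by
    by_contra h1
    exact hex w hw 0 hcw ⟨a, ha, by omega, Or.inr haw⟩
  have hb2 : b % 2 = 1 := by
    by_contra h1
    exact hex u hu 1 hcu ⟨b, hb, by omega, Or.inl hub⟩
  have pw : ∀ i j, j ≤ k + 2 → j + 2 = i + k → A w (P i) → ¬ A (P j) u := fun i j hj hij h1 h2 =>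
    hno (h.dAdj_of_out_in hw hu hwu hj hij h1 h2)
  have pu : ∀ i j, j ≤ k + 2 → j + 2 = i + k → A u (P i) → ¬ A (P j) w := fun i j hj hij h1 h2 =>
    hno (h.dAdj_of_out_in hu hw hwu.symm hj hij h1 h2).symm
  have ww : ∀ i, i ≤ k + 2 → i % 2 = 0 → (i ≤ 3 ∨ k - 1 ≤ i) → DAdj A w (P i) :=
    fun i hi hp hi' => h.dAdj_window hw hcw hi hp hi'
  have wu : ∀ i, i ≤ k + 2 → i % 2 = 1 → (i ≤ 3 ∨ k - 1 ≤ i) → DAdj A u (P i) :=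
    fun i hi hp hi' => h.dAdj_window hu hcu hi hp hi'
  have byp := fun i j x => h.not_bypass i j x
  by_cases hu1 : A u (P 1)
  · have w1 := pu 1 (k - 1) (by omega) (by omega) hu1
    have w2 := (ww (k - 1) (by omega) (by omega) (by omega)).resolve_right w1
    have w3 : A (P (k + 1)) w := by
      by_contra w3
      have w4 := (ww (k + 1) (by omega) (by omega) (by omega)).resolve_right w3
      have h1 : ¬ a + 2 < k + 1 := fun h1 => byp a (k + 1) w h1 (by omega) haw w4
      obtain rfl | rfl : a = k - 1 ∨ a = k + 1 := by omega
      · exact w1 haw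
      · exact w3 haw
    have u3 := (wu 3 (by omega) rfl (by omega)).resolve_left
      (fun u3 => pu 3 (k + 1) (by omega) (by omega) u3 w3)
    rcases Nat.lt_or_ge 5 k with h6 | h6
    · have uk := (wu k (by omega) (by omega) (by omega)).resolve_left
        (byp 3 k u (by omega) (by omega) u3)
      have w4 := (ww 2 (by omega) rfl (by omega)).resolve_left
        (fun w4 => pw 2 k (by omega) (by omega) w4 uk)
      exact byp 2 (k - 1) w (by omega) (by omega) w4 w2
    · obtain rfl : k = 5 := by omega
      have uk := (wu 7 (by omega) (by omega) (by omega)).resolve_left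
        (byp 3 7 u (by omega) (by omega) u3)
      exact pw 4 7 (by omega) (by omega) w2 uk
  · have u1 := (wu 1 (by omega) rfl (by omega)).resolve_left hu1
    have u3 : A u (P 3) := by
      have h1 : ¬ 1 + 2 < b := fun h1 => byp 1 b u h1 hb u1 hub
      obtain rfl | rfl : b = 1 ∨ b = 3 := by omega
      · exact absurd hub hu1
      · exact hub
    have w1 := (ww (k + 1) (by omega) (by omega) (by omega)).resolve_right
      (pu 3 (k + 1) (by omega) (by omega) u3)
    have uk := (wu k (by omega) (by omega) (by omega)).resolve_left
      (byp 1 k u (by omega) (by omega) u1)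
    have w2 := (ww 2 (by omega) rfl (by omega)).resolve_left
        (fun w2 => pw 2 k (by omega) (by omega) w2 uk)
    exact byp 2 (k + 1) w (by omega) (by omega) w2 w1

lemma out_first (h : IsLongGeodesic A k P) (hu : u ∉ VertsUpTo (k + 2) P)
    (htype : ∀ c, HasType A k P u c) {b : ℕ} (hb : b ≤ k + 2) (hub : A u (P b)) :
    A u (P 0) ∨ A u (P 1) ∨ A u (P 2) := by
  rcases h.dAdj_window hu (htype 0) (i := 0) (by omega) rfl (by omega) with h0 | h0
  · exact Or.inl h0
  have h1 : ¬ 0 + 2 < b := fun h1 => h.not_bypass 0 b u h1 hb h0 hub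
  interval_cases b <;> tauto

lemma in_last (h : IsLongGeodesic A k P) (hu : u ∉ VertsUpTo (k + 2) P)
    (htype : ∀ c, HasType A k P u c) {a : ℕ} (ha : a ≤ k + 2) (hau : A (P a) u) :
    A (P k) u ∨ A (P (k + 1)) u ∨ A (P (k + 2)) u := by
  have hk := h.odd
  rcases h.dAdj_window hu (htype (k + 2)) (i := k + 2) (by omega) rfl (by omega) with h0 | h0
  · have h1 : ¬ a + 2 < k + 2 := fun h1 => h.not_bypass a (k + 2) u h1 le_rfl hau h0
    obtain rfl | rfl | rfl : a = k ∨ a = k + 1 ∨ a = k + 2 := by omega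
    all_goals tauto
  · exact Or.inr (Or.inr h0)

lemma dAdj_of_both_types_of_in (h : IsLongGeodesic A k P)
    (htype : ∀ x ∉ VertsUpTo (k + 2) P, ∀ c, HasType A k P x c)
    (hw : w ∉ VertsUpTo (k + 2) P) (hu : u ∉ VertsUpTo (k + 2) P) (hwu : w ≠ u)
    {b : ℕ} (hb : b ≤ k + 2) (hub : A u (P b)) (huk : A (P k) u) :
    DAdj A w u := by
  have h5 := h.five_le
  have hk := h.odd
  by_contra hno
  have pw : ∀ i j, j ≤ k + 2 → j + 2 = i + k → A w (P i) → ¬ A (P j) u := fun i j hj hij h1 h2 =>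
    hno (h.dAdj_of_out_in hw hu hwu hj hij h1 h2)
  have pu : ∀ i j, j ≤ k + 2 → j + 2 = i + k → A u (P i) → ¬ A (P j) w := fun i j hj hij h1 h2 =>
    hno (h.dAdj_of_out_in hu hw hwu.symm hj hij h1 h2).symm
  have win : ∀ x ∉ VertsUpTo (k + 2) P, ∀ i, i ≤ k + 2 → (i ≤ 3 ∨ k - 1 ≤ i) → DAdj A x (P i) :=
    fun x hx i hi hi' => h.dAdj_window hx (htype x hx i) hi rfl hi'
  have large : ∀ x ∉ VertsUpTo (k + 2) P, A (P 2) x → ∀ j, k - 1 ≤ j → 5 ≤ j → j ≤ k + 2 →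
      A (P j) x := fun x hx h2 j hj hj5 hj2 =>
    (win x hx j hj2 (Or.inr hj)).resolve_left (h.not_bypass 2 j x (by omega) hj2 h2)
  have w2 := (win w hw 2 (by omega) (by omega)).resolve_left
    (fun w2 => pw 2 k (by omega) (by omega) w2 huk)
  have wl := large w hw w2
  have u2' : ¬ A u (P 2) :=
    fun u2 => pu 2 k (by omega) (by omega) u2 (wl k (by omega) (by omega) (by omega))
  have u2 := (win u hu 2 (by omega) (by omega)).resolve_left u2'
  have ul := large u hu u2
  have w3 := (win w hw 3 (by omega) (by omega)).resolve_left
    (fun w3 => pw 3 (k + 1) (by omega) (by omega) w3 (ul _ (by omega) (by omega) (by omega)))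
  have wp : A (P (k - 1)) w := by
    refine (win w hw (k - 1) (by omega) (by omega)).resolve_left (fun w4 => ?_)
    rcases Nat.lt_or_ge 5 k with h6 | h6
    · exact h.not_bypass 2 (k - 1) w (by omega) (by omega) w2 w4
    · rw [show k - 1 = 4 by omega] at w4
      exact pw 4 (k + 2) (by omega) (by omega) w4 (ul _ (by omega) (by omega) (by omega))
  have wpp : A (P (k - 2)) w := by
    rcases Nat.lt_or_ge 5 k with h6 | h6
    · exact (h.dAdj_of_ge hw w3 (by omega) (by omega) (by omega)).resolve_left
        (fun w4 => by
          rcases Nat.lt_or_ge 7 k with h8 | h8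
          · exact h.not_bypass 3 (k - 2) w (by omega) (by omega) w3 w4
          · exact h.not_bypass 2 (k - 2) w (by omega) (by omega) w2 w4)
    · rwa [show k - 2 = 3 by omega]
  rcases h.out_first hu (htype u hu) hb hub with h1 | h1 | h1
  · exact pu 0 (k - 2) (by omega) (by omega) h1 wpp
  · exact pu 1 (k - 1) (by omega) (by omega) h1 wp
  · exact u2' h1

lemma dAdj_of_both_types (h : IsLongGeodesic A k P)
    (htype : ∀ x ∉ VertsUpTo (k + 2) P, ∀ c, HasType A k P x c)
    (hw : w ∉ VertsUpTo (k + 2) P) (hu : u ∉ VertsUpTo (k + 2) P) (hwu : w ≠ u)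
    {a b d : ℕ} (ha : a ≤ k + 2) (hau : A (P a) u) (hb : b ≤ k + 2) (hub : A u (P b))
    (hd : d ≤ k + 2) (hwd : A w (P d)) : DAdj A w u := by
  have h5 := h.five_le
  have hk := h.odd
  by_contra hno
  have pw : ∀ i j, j ≤ k + 2 → j + 2 = i + k → A w (P i) → ¬ A (P j) u := fun i j hj hij h1 h2 =>
    hno (h.dAdj_of_out_in hw hu hwu hj hij h1 h2)
  have win : ∀ x ∉ VertsUpTo (k + 2) P, ∀ i, i ≤ k + 2 → (i ≤ 3 ∨ k - 1 ≤ i) → DAdj A x (P i) :=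
    fun x hx i hi hi' => h.dAdj_window hx (htype x hx i) hi rfl hi'
  have uk' : ¬ A (P k) u := fun huk => hno (h.dAdj_of_both_types_of_in htype hw hu hwu hb hub huk)
  have wk' : ¬ A (P k) w := fun hwk =>
    hno (h.dAdj_of_both_types_of_in htype hu hw hwu.symm hd hwd hwk).symm
  have wk := (win w hw k (by omega) (by omega)).resolve_right wk'
  have uk := (win u hu k (by omega) (by omega)).resolve_right uk'
  have pu : ∀ i j, j ≤ k + 2 → j + 2 = i + k → A u (P i) → ¬ A (P j) w := fun i j hj hij h1 h2 =>
    hno (h.dAdj_of_out_in hu hw hwu.symm hj hij h1 h2).symm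
  have u0 := (win u hu 0 (by omega) (by omega)).resolve_right
    (fun h0 => h.not_bypass 0 k u (by omega) (by omega) h0 uk)
  have u1 := (win u hu 1 (by omega) (by omega)).resolve_right
    (fun h0 => h.not_bypass 1 k u (by omega) (by omega) h0 uk)
  have w3 : A w (P 3) := by
    refine (win w hw 3 (by omega) (by omega)).resolve_right (fun h3 => ?_)
    rcases Nat.lt_or_ge 5 k with h6 | h6
    · exact h.not_bypass 3 k w (by omega) (by omega) h3 wk
    · exact pu 0 3 (by omega) (by omega) u0 h3
  have wp := (win w hw (k - 1) (by omega) (by omega)).resolve_right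
    (pu 1 (k - 1) (by omega) (by omega) u1)
  have w4 : A w (P 4) := by
    rcases Nat.lt_or_ge 5 k with h6 | h6
    · exact (h.dAdj_of_le hw wp (by omega) (by omega) (by omega)).resolve_right
        (fun h4 => h.not_bypass 4 k w (by omega) (by omega) h4 wk)
    · rwa [show k - 1 = 4 by omega] at wp
  rcases h.in_last hu (htype u hu) ha hau with h1 | h1 | h1
  · exact uk' h1
  · exact pw 3 (k + 1) (by omega) (by omega) w3 h1
  · exact pw 4 (k + 2) (by omega) (by omega) w4 h1

end Mixed

/-- Outside vertices with neighbours of different parities on the path are adjacent. -/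
lemma dAdj_of_hasType (h : IsLongGeodesic A k P) (hG : UniformTypes A k P) {w u : V}
    (hw : w ∉ VertsUpTo (k + 2) P) (hu : u ∉ VertsUpTo (k + 2) P) (hwu : w ≠ u)
    (hcw : HasType A k P w 0) (hcu : HasType A k P u 1) : DAdj A w u := by
  have hk := h.odd
  by_cases hwin : ∀ x ∈ VertsUpTo (k + 2) P, ¬ A x w
  · exact h.dAdj_of_no_in hG hw hu hwu hcw hcu hwin
  by_cases huin : ∀ x ∈ VertsUpTo (k + 2) P, ¬ A x u
  · exact (h.dAdj_of_no_in hG hu hw hwu.symm hcu (hcw.congr rfl) huin).symm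
  have hfl := fun x (hx : x ∉ VertsUpTo (k + 2) P) => (vertsUpTo_flip (k + 2) P).symm ▸ hx
  by_cases hwout : ∀ x ∈ VertsUpTo (k + 2) P, ¬ A w x
  · refine dAdj_flip.1 (h.flip.dAdj_of_no_in (uniformTypes_flip hk hG) (c := 1) (hfl w hw)
      (hfl u hu) hwu ((hasType_flip hk rfl).2 hcw) ((hasType_flip hk rfl).2 hcu) ?_)
    rwa [vertsUpTo_flip]
  by_cases huout : ∀ x ∈ VertsUpTo (k + 2) P, ¬ A u x
  · refine (dAdj_flip.1 (h.flip.dAdj_of_no_in (uniformTypes_flip hk hG) (c := 0) (hfl u hu)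
      (hfl w hw) hwu.symm ((hasType_flip hk rfl).2 hcu) ((hasType_flip hk rfl).2 hcw) ?_)).symm
    rwa [vertsUpTo_flip]
  push Not at hwin huin hwout huout
  obtain ⟨_, ⟨a, ha, rfl⟩, haw⟩ := hwin
  obtain ⟨_, ⟨b, hb, rfl⟩, hub⟩ := huout
  rcases hG with hG | hG
  · obtain ⟨_, ⟨e, he, rfl⟩, heu⟩ := huin
    obtain ⟨_, ⟨d, hd, rfl⟩, hwd⟩ := hwout
    exact h.dAdj_of_both_types hG hw hu hwu he heu hb hub hd hwd
  · exact h.dAdj_of_single_types hG hw hu hwu hcw hcu ha haw hb hub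

lemma dAdj_of_opposite_parity (h : IsLongGeodesic A k P) {i j : ℕ} (hi : i ≤ k + 2)
    (hj : j ≤ k + 2) (hp : i % 2 ≠ j % 2) : DAdj A (P i) (P j) := by
  have key : ∀ i j, i < j → j ≤ k + 2 → i % 2 ≠ j % 2 → DAdj A (P i) (P j) := by
    intro i j hij hj hp
    rcases Nat.lt_or_ge (i + 1) j with h1 | h1
    · exact Or.inr (h.arc_back j i hj (by omega) (by omega))
    · obtain rfl : j = i + 1 := by omega
      exact Or.inl (h.arc i (by omega))
  rcases Nat.lt_or_ge i j with h1 | h1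
  · exact key i j h1 hj hp
  · exact (key j i (by omega) hi hp.symm).symm

lemma semicomplete_of_evenArc (h : IsLongGeodesic A k P) (he : HasEvenArc A k P) :
    SemicompleteOn A (VertsUpTo (k + 2) P) ∧ SemicompleteOn A {w | w ∉ VertsUpTo (k + 2) P} := by
  refine ⟨?_, fun x hx y hy hxy => ?_⟩
  · rintro _ ⟨i, hi, rfl⟩ _ ⟨j, hj, rfl⟩ hne
    by_cases hp : i % 2 = j % 2
    · rcases lt_trichotomy i j with h1 | rfl | h1
      · exact Or.inr (h.arc_back_of_evenArc he j i hj (by omega))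
      · exact absurd rfl hne
      · exact Or.inl (h.arc_back_of_evenArc he i j hi (by omega))
    · exact h.dAdj_of_opposite_parity hi hj hp
  · exact h.dAdj_of_hasType (Or.inl fun x hx c => h.hasType_of_evenArc he hx c) hx hy hxy
      (h.hasType_of_evenArc he hx 0) (h.hasType_of_evenArc he hy 1)

lemma semicompleteBipartite_of_not_evenArc (h : IsLongGeodesic A k P) (hirr : ∀ x, ¬ A x x)
    (he : ¬ HasEvenArc A k P) :
    SemicompleteBipartiteOn A (VertsUpTo (k + 2) P) ∧
      SemicompleteBipartiteOn A {w | w ∉ VertsUpTo (k + 2) P} := by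
  have hex : ∀ x ∉ VertsUpTo (k + 2) P, ∀ c, HasType A k P x c → ¬ HasType A k P x (c + 1) := by
    intro x hx c h1 h2
    refine he (h.hasEvenArc_of_hasType hx fun d => ?_)
    rcases Nat.mod_two_eq_zero_or_one (c + d) with hd | hd
    · exact h1.congr (by omega)
    · exact h2.congr (by omega)
  have hself : ∀ x, ¬ DAdj A x x := fun x hx => hx.elim (hirr x) (hirr x)
  have hsame : ∀ i j, i ≤ k + 2 → j ≤ k + 2 → i % 2 = j % 2 → ¬ DAdj A (P i) (P j) := by
    intro i j hi hj hp ha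
    rcases eq_or_ne i j with rfl | hij
    · exact hself _ ha
    · exact he (h.hasEvenArc_of_dAdj hi hj hij hp ha)
  have htype : ∀ c, ∀ x ∉ VertsUpTo (k + 2) P, ∀ y ∉ VertsUpTo (k + 2) P,
      HasType A k P x c → HasType A k P y c → ¬ DAdj A x y := by
    intro c x hx y hy hcx hcy ha
    rcases eq_or_ne x y with rfl | hxy
    · exact hself _ ha
    · exact ha.elim (h.not_arc_of_hasType hex hx hy hxy hcx hcy)
        (h.not_arc_of_hasType hex hy hx hxy.symm hcy hcx)
  constructor
  · refine ⟨{w | ∃ i ≤ k + 2, i % 2 = 0 ∧ P i = w}, {w | ∃ i ≤ k + 2, i % 2 = 1 ∧ P i = w},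
      ?_, ?_, ?_, ?_, ?_⟩
    · ext w
      constructor
      · rintro (⟨i, hi, -, rfl⟩ | ⟨i, hi, -, rfl⟩) <;> exact mem_verts hi
      · rintro ⟨i, hi, rfl⟩
        rcases Nat.mod_two_eq_zero_or_one i with hp | hp
        · exact Or.inl ⟨i, hi, hp, rfl⟩
        · exact Or.inr ⟨i, hi, hp, rfl⟩
    · rw [Set.eq_empty_iff_forall_notMem]
      rintro _ ⟨⟨i, hi, hi2, rfl⟩, ⟨j, hj, hj2, hij⟩⟩
      have := h.inj j i hj hi hij
      omega
    · rintro _ ⟨i, hi, hi2, rfl⟩ _ ⟨j, hj, hj2, rfl⟩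
      exact hsame i j hi hj (by omega)
    · rintro _ ⟨i, hi, hi2, rfl⟩ _ ⟨j, hj, hj2, rfl⟩
      exact hsame i j hi hj (by omega)
    · rintro _ ⟨i, hi, hi2, rfl⟩ _ ⟨j, hj, hj2, rfl⟩
      exact h.dAdj_of_opposite_parity hi hj (by omega)
  · refine ⟨{w | w ∉ VertsUpTo (k + 2) P ∧ HasType A k P w 0},
      {w | w ∉ VertsUpTo (k + 2) P ∧ HasType A k P w 1}, ?_, ?_, ?_, ?_, ?_⟩
    · ext w
      constructor
      · rintro (hw | hw) <;> exact hw.1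
      · intro hw
        obtain ⟨c, hc⟩ := h.exists_hasType hw
        rcases Nat.mod_two_eq_zero_or_one c with hp | hp
        · exact Or.inl ⟨hw, hc.congr (by omega)⟩
        · exact Or.inr ⟨hw, hc.congr (by omega)⟩
    · rw [Set.eq_empty_iff_forall_notMem]
      rintro w ⟨⟨hw, h0⟩, ⟨-, h1⟩⟩
      exact hex w hw 0 h0 h1
    · exact fun x hx y hy => htype 0 x hx.1 y hy.1 hx.2 hy.2
    · exact fun x hx y hy => htype 1 x hx.1 y hy.1 hx.2 hy.2
    · intro x hx y hy
      refine h.dAdj_of_hasType (Or.inr hex) hx.1 hy.1 ?_ hx.2 hy.2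
      rintro rfl
      exact hex x hx.1 0 hx.2 hy.2

end IsLongGeodesic

lemma IsDipathOn.dipathIn {A : V → V → Prop} {n : ℕ} {P : ℕ → V} (hP : IsDipathOn A n P)
    {i j : ℕ} (hij : i ≤ j) (hj : j ≤ n) :
    DipathIn A {w | ∃ t, i ≤ t ∧ t ≤ j ∧ P t = w} (j - i) (P i) (P j) := by
  refine ⟨fun t => P (i + t), ⟨fun s t hs ht hst => ?_, fun t ht => hP.2 _ (by omega)⟩, rfl, ?_,
    fun t ht => ⟨i + t, by omega, by omega, rfl⟩⟩
  · have := hP.1 _ _ (by omega) (by omega) hst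
    omega
  · simp only [show i + (j - i) = j by omega]

lemma DipathIn.hasDipath {A : V → V → Prop} {S : Set V} {n : ℕ} {x y : V}
    (h : DipathIn A S n x y) : HasDipath A n x y := by
  obtain ⟨f, hf, h0, hn, -⟩ := h
  exact ⟨f, hf, h0, hn⟩

lemma StrongD.reflTransGen {A : V → V → Prop} (h : StrongD A) (x y : V) :
    Relation.ReflTransGen A x y := by
  obtain ⟨n, f, ⟨-, hf⟩, rfl, rfl⟩ := h x y
  have key : ∀ i ≤ n, Relation.ReflTransGen A (f 0) (f i) := by
    intro i
    induction i with
    | zero => exact fun _ => .refl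
    | succ i ih => exact fun hi => (ih (by omega)).tail (hf i hi)
  exact key n le_rfl

lemma IsDipathOn.isLongGeodesic {A : V → V → Prop} {k : ℕ} {P : ℕ → V} (h5 : 5 ≤ k)
    (hodd : k % 2 = 1) (hQ : KQuasiTransitive A k) (hstrong : StrongD A)
    (hP : IsDipathOn A (k + 2) P)
    (hdist : ∀ m, m < k + 2 → ¬ HasDipath A m (P 0) (P (k + 2))) : IsLongGeodesic A k P := by
  have skip : ∀ i j, i + 1 < j → j ≤ k + 2 → ¬ A (P i) (P j) := by
    intro i j hij hj ha
    refine hdist _ ?_ (((hP.dipathIn (Nat.zero_le i) (by omega)).append ha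
      (hP.dipathIn hj le_rfl) ?_).hasDipath)
    · omega
    · rintro _ ⟨s, -, hs, rfl⟩ ⟨t, ht, ht', hst⟩
      have := hP.1 _ _ (by omega) (by omega) hst
      omega
  refine ⟨h5, hodd, hQ, hstrong.reflTransGen, hP.1, hP.2, skip, ?_⟩
  intro i j v hij hj h1 h2
  by_cases hv : ∃ m ≤ k + 2, P m = v
  · obtain ⟨m, hm, rfl⟩ := hv
    have h3 : ¬ i + 1 < m := fun h3 => skip i m h3 hm h1
    exact skip m j (by omega) hj h2
  · push Not at hv
    refine hdist _ ?_ (((hP.dipathIn (Nat.zero_le i) (by omega)).append h1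
      ((hP.dipathIn hj le_rfl).cons h2 ?_) ?_).hasDipath)
    · omega
    · rintro ⟨t, -, ht, rfl⟩
      exact hv t ht rfl
    · rintro _ ⟨s, -, hs, rfl⟩ (h3 | ⟨t, ht, ht', hst⟩)
      · exact hv s (by omega) h3
      · have := hP.1 _ _ (by omega) (by omega) hst
        omega

theorem stmt_0
    {V : Type*} [Fintype V] (A : V → V → Prop) (hirr : Irreflexive A)
    (k : ℕ) (hk5 : 5 ≤ k) (hkodd : Odd k)
    (hQT : KQuasiTransitive A k) (hstrong : StrongD A)
    (u v : V) (hdist : ∀ m, m < k + 2 → ¬ HasDipath A m u v)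
    (P : ℕ → V) (hP : IsDipathOn A (k + 2) P) (hPu : P 0 = u) (hPv : P (k + 2) = v) :
    (SemicompleteOn A (VertsUpTo (k + 2) P) ∨
      SemicompleteBipartiteOn A (VertsUpTo (k + 2) P)) ∧
    (SemicompleteOn A {w | w ∉ VertsUpTo (k + 2) P} ∨
      SemicompleteBipartiteOn A {w | w ∉ VertsUpTo (k + 2) P} ∨
      EmptyOn A {w | w ∉ VertsUpTo (k + 2) P}) := by
  subst hPu hPv
  have h := hP.isLongGeodesic hk5 (Nat.odd_iff.1 hkodd) hQT hstrong hdist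
  by_cases he : HasEvenArc A k P
  · exact (h.semicomplete_of_evenArc he).imp Or.inl Or.inl
  · exact (h.semicompleteBipartite_of_not_evenArc (fun x => hirr x) he).imp Or.inr
      (fun hb => Or.inr (Or.inl hb))
end

section
/- Every vertex of E(P) is adjacent to every vertex of O(P); that is, D[V(P)] contains a semicomplete bipartite digraph with bipartition (O(P), E(P)) as a subdigraph. -/
variable {V : Type*}

/-- Reindexing a path by `g` gives a path when `g` is injective and each step of `g` is an arc. -/
theorem IsDipathOn.comp_index {A : V → V → Prop} {n m : ℕ} {P : ℕ → V} (hP : IsDipathOn A n P)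
    {g : ℕ → ℕ} (hle : ∀ t ≤ m, g t ≤ n) (hinj : ∀ s t, s ≤ m → t ≤ m → g s = g t → s = t)
    (harc : ∀ t < m, A (P (g t)) (P (g (t + 1)))) : IsDipathOn A m (P ∘ g) :=
  ⟨fun s t hs ht h => hinj s t hs ht (hP.1 _ _ (hle s hs) (hle t ht) h), harc⟩

/-- Two disjoint segments `a..b` and `c..d` of a path joined by an arc form a path. -/
theorem IsDipathOn.join_two {A : V → V → Prop} {n m a b c d : ℕ} {P : ℕ → V}
    (hP : IsDipathOn A n P) (hab : a ≤ b) (hbn : b ≤ n) (hcd : c ≤ d) (hdn : d ≤ n)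
    (hdisj : b < c ∨ d < a) (hbc : A (P b) (P c)) (hm : m + a + c = b + d + 1) :
    HasDipath A m (P a) (P d) := by
  refine ⟨P ∘ fun t => if t ≤ b - a then a + t else c + (t - (b - a + 1)),
    hP.comp_index ?_ ?_ ?_, ?_, ?_⟩
  · intro t ht
    split_ifs <;> omega
  · intro s t hs ht h
    split_ifs at h <;> omega
  · intro t ht
    by_cases h : t < b - a
    · rw [if_pos (by omega), if_pos (by omega)]
      exact hP.2 _ (by omega)
    by_cases h' : t = b - a
    · rw [if_pos (by omega), if_neg (by omega)]
      convert hbc using 2 <;> omega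
    · rw [if_neg (by omega), if_neg (by omega)]
      convert hP.2 (c + (t - (b - a + 1))) (by omega) using 2
      omega
  · simp
  · simp only [Function.comp]
    rw [if_neg (by omega)]
    congr 1
    omega

/-- Segments `e..f`, `c..d`, `a..b` of a path, occurring in this order along it and joined by
arcs from `b` to `c` and from `d` to `e`, form a path. -/
theorem IsDipathOn.join_three {A : V → V → Prop} {n m a b c d e f : ℕ} {P : ℕ → V}
    (hP : IsDipathOn A n P) (hab : a ≤ b) (hbn : b ≤ n) (hcd : c ≤ d) (hef : e ≤ f)
    (hda : d < a) (hfc : f < c) (hbc : A (P b) (P c)) (hde : A (P d) (P e))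
    (hm : m + a + c + e = b + d + f + 2) : HasDipath A m (P a) (P f) := by
  refine ⟨P ∘ fun t => if t ≤ b - a then a + t else if t ≤ b - a + 1 + (d - c) then
      c + (t - (b - a + 1)) else e + (t - (b - a + 1 + (d - c) + 1)),
    hP.comp_index ?_ ?_ ?_, ?_, ?_⟩
  · intro t ht
    split_ifs <;> omega
  · intro s t hs ht h
    split_ifs at h <;> omega
  · intro t ht
    by_cases h₁ : t < b - a
    · rw [if_pos (by omega), if_pos (by omega)]
      exact hP.2 _ (by omega)
    by_cases h₂ : t = b - a
    · rw [if_pos (by omega), if_neg (by omega), if_pos (by omega)]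
      convert hbc using 2 <;> omega
    by_cases h₃ : t < b - a + 1 + (d - c)
    · rw [if_neg (by omega), if_pos (by omega), if_neg (by omega), if_pos (by omega)]
      convert hP.2 (c + (t - (b - a + 1))) (by omega) using 2
      omega
    by_cases h₄ : t = b - a + 1 + (d - c)
    · rw [if_neg (by omega), if_pos (by omega), if_neg (by omega), if_neg (by omega)]
      convert hde using 2 <;> omega
    · rw [if_neg (by omega), if_neg (by omega), if_neg (by omega), if_neg (by omega)]
      convert hP.2 (e + (t - (b - a + 1 + (d - c) + 1))) (by omega) using 2
      omega
  · simp
  · simp only [Function.comp]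
    rw [if_neg (by omega), if_neg (by omega)]
    congr 1
    omega

/-- In a `k`-quasi-transitive digraph, the endpoints of a path of length `k` are adjacent. -/
theorem KQuasiTransitive.dAdj {A : V → V → Prop} {k : ℕ} (hQT : KQuasiTransitive A k) {x y : V}
    (h : HasDipath A k x y) : DAdj A x y := by
  obtain ⟨p, hp, rfl, rfl⟩ := h
  exact hQT p hp

/-- A shortest path has no forward chords. -/
theorem IsDipathOn.not_forward_arc {A : V → V → Prop} {n : ℕ} {P : ℕ → V}
    (hP : IsDipathOn A n P) (hmin : ∀ m < n, ¬ HasDipath A m (P 0) (P n)) {i j : ℕ}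
    (hij : i + 1 < j) (hj : j ≤ n) : ¬ A (P i) (P j) := fun h =>
  hmin (i + 1 + n - j) (by omega)
    (hP.join_two (Nat.zero_le i) (by omega) hj le_rfl (by omega) h (by omega))

/-- On a shortest path of length `k + 2` in a `k`-quasi-transitive digraph with `k` odd, there is an
arc from each vertex to each earlier vertex at odd distance at least three. -/
theorem KQuasiTransitive.backward_arc {A : V → V → Prop} {k : ℕ} (hQT : KQuasiTransitive A k)
    (hk : 3 ≤ k) (hkodd : Odd k) {P : ℕ → V} (hP : IsDipathOn A (k + 2) P)
    (hmin : ∀ m < k + 2, ¬ HasDipath A m (P 0) (P (k + 2))) {i j : ℕ} (hi : i ≤ k + 2)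
    (hji : j + 3 ≤ i) (hodd : Odd (i + j)) : A (P i) (P j) := by
  have back : ∀ {s t : ℕ}, s ≤ k + 2 → t + 1 < s → DAdj A (P s) (P t) → A (P s) (P t) :=
    fun hs hts h => h.resolve_right (hP.not_forward_arc hmin hts hs)
  have gap_k : ∀ s ≤ 2, A (P (s + k)) (P s) := fun s hs =>
    back (by omega) (by omega) (hQT.dAdj (hP.join_two (a := s) (b := s) (c := s + 1) (d := s + k)
      le_rfl (by omega) (by omega) (by omega) (by omega) (hP.2 s (by omega)) (by omega))).symm
  have last_first : A (P (k + 2)) (P 0) :=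
    back le_rfl (by omega) (hQT.dAdj (hP.join_three (b := k + 2) (c := 2) (d := k) (e := 0)
      le_rfl le_rfl (by omega) le_rfl (by omega) (by omega)
      (by simpa [add_comm] using gap_k 2 le_rfl) (by simpa using gap_k 0 (by omega)) (by omega)))
  have gap_three : ∀ s, s + 3 ≤ k + 2 → A (P (s + 3)) (P s) := fun s hs =>
    back hs (by omega) (hQT.dAdj (hP.join_two hs le_rfl (Nat.zero_le s) (by omega) (by omega)
      last_first (by omega)))
  have from_last : ∀ r, 2 * r + 3 ≤ k + 2 → A (P (k + 2)) (P (k + 2 - (2 * r + 3))) := by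
    intro r
    induction r with
    | zero =>
      intro h
      simpa [show k - 1 + 3 = k + 2 by omega] using gap_three (k - 1) (by omega)
    | succ r ih =>
      intro h
      exact back le_rfl (by omega) (hQT.dAdj (hP.join_three (b := k + 2)
        (c := k + 2 - (2 * r + 3)) (d := k) (e := 0) le_rfl le_rfl (by omega) (by omega)
        (by omega) (by omega) (ih (by omega)) (by simpa using gap_k 0 (by omega)) (by omega)))
  have to_first : ∀ r, 2 * r + 3 ≤ k + 2 → A (P (2 * r + 3)) (P 0) := by
    intro r
    induction r with
    | zero => exact gap_three 0
    | succ r ih =>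
      intro h
      exact back h (by omega) (hQT.dAdj (hP.join_three (b := k + 2) (c := 2) (d := 2 * r + 3)
        (e := 0) (by omega) le_rfl (by omega) le_rfl (by omega) (by omega)
        (by simpa [add_comm] using gap_k 2 le_rfl) (ih (by omega)) (by omega)))
  have last_even : ∀ c, Even c → c + 3 ≤ k + 2 → A (P (k + 2)) (P c) := by
    rintro c ⟨c', hc⟩ h
    obtain ⟨k', hk'⟩ := hkodd
    have := from_last (k' - c') (by omega)
    rwa [show k + 2 - (2 * (k' - c') + 3) = c by omega] at this
  have odd_first : ∀ d, Odd d → 3 ≤ d → d ≤ k + 2 → A (P d) (P 0) := by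
    rintro d ⟨d', hd⟩ h h'
    have := to_first (d' - 1) (by omega)
    rwa [show 2 * (d' - 1) + 3 = d by omega] at this
  obtain rfl | hlt : i = j + 3 ∨ j + 5 ≤ i := by
    obtain ⟨r, hr⟩ := hodd
    omega
  · exact gap_three j hi
  rcases Nat.even_or_odd j with hj | hj
  · have hiodd : Odd (i - 2) := by grind
    exact back hi (by omega) (hQT.dAdj (hP.join_three (b := k + 2) (c := j + 2) (d := i - 2)
      (e := 0) hi le_rfl (by omega) (Nat.zero_le j) (by omega) (by omega)
      (last_even _ (by grind) (by omega)) (odd_first _ hiodd (by omega) (by omega)) (by omega)))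
  · have hiodd : Odd (i - 1) := by grind
    exact back hi (by omega) (hQT.dAdj (hP.join_three (b := k + 2) (c := j + 3) (d := i - 1)
      (e := 0) hi le_rfl (by omega) (Nat.zero_le j) (by omega) (by omega)
      (last_even _ (by grind) (by grind)) (odd_first _ hiodd (by omega) (by omega)) (by omega)))

theorem stmt_1
    {V : Type*} [Fintype V] (A : V → V → Prop) (hirr : Irreflexive A)
    (k : ℕ) (hk5 : 5 ≤ k) (hkodd : Odd k)
    (hQT : KQuasiTransitive A k) (hstrong : StrongD A)
    (u v : V) (hdist : ∀ m, m < k + 2 → ¬ HasDipath A m u v)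
    (P : ℕ → V) (hP : IsDipathOn A (k + 2) P) (hPu : P 0 = u) (hPv : P (k + 2) = v) :
    ∀ a ∈ EvenVertsUpTo (k + 2) P, ∀ b ∈ OddVertsUpTo (k + 2) P, DAdj A a b := by
  rintro _ ⟨i, hi, hie, rfl⟩ _ ⟨j, hj, hjo, rfl⟩
  subst hPu hPv
  have hodd : Odd (i + j) := hie.add_odd hjo
  obtain h | h | h | h : j = i + 1 ∨ i = j + 1 ∨ i + 3 ≤ j ∨ j + 3 ≤ i := by
    obtain ⟨r, hr⟩ := hodd
    omega
  · subst h
    exact Or.inl (hP.2 i (by omega))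
  · subst h
    exact Or.inr (hP.2 j (by omega))
  · exact Or.inr (hQT.backward_arc (by omega) hkodd hP hdist hj h (by rwa [add_comm]))
  · exact Or.inl (hQT.backward_arc (by omega) hkodd hP hdist hi h hodd)
end

section
/- Let x_t and x_s be vertices of P with s > t such that s and t have the same parity. Then there is a directed path of length k−1 from x_s to x_t all of whose vertices lie in V(P). Moreover, for any x ∈ V(D)∖V(P): if x→x_s is an arc, then x and x_t are adjacent, and furthermore x→x_t whenever s ≥ t+4; if x_t→x is an arc, then x and x_s are adjacent, and furthermore x_s→x whenever s ≥ t+4. -/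
variable {V : Type*}

/-- Running along `P` from `a` to `b`, jumping to `c` and running on to `e`, with `e < a`,
gives a directed path. -/
theorem IsDipathOn.two_runs {A : V → V → Prop} {N : ℕ} {P : ℕ → V} (hP : IsDipathOn A N P)
    {a b c e : ℕ} (hab : a ≤ b) (hbN : b ≤ N) (hce : c ≤ e) (hea : e < a)
    (hbc : A (P b) (P c)) :
    ∃ Q : ℕ → V, IsDipathOn A (b - a + 1 + (e - c)) Q ∧ Q 0 = P a ∧
      Q (b - a + 1 + (e - c)) = P e ∧
      ∀ i ≤ b - a + 1 + (e - c), Q i ∈ VertsUpTo N P := by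
  refine ⟨fun n => P (if n ≤ b - a then a + n else c + (n - (b - a) - 1)),
    ⟨fun i j hi hj hij => ?_, fun i hi => ?_⟩, ?_, ?_, fun i hi => ⟨_, ?_, rfl⟩⟩
  · have := hP.1 _ _ (by split_ifs <;> omega) (by split_ifs <;> omega) hij
    split_ifs at this <;> omega
  · dsimp only
    rcases lt_trichotomy i (b - a) with h | h | h
    · rw [if_pos (by omega), if_pos (by omega)]
      exact hP.2 _ (by omega)
    · rw [if_pos (by omega), if_neg (by omega)]
      convert hbc using 2 <;> omega
    · rw [if_neg (by omega), if_neg (by omega)]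
      convert hP.2 (c + (i - (b - a) - 1)) (by omega) using 2
      omega
  · simp
  · dsimp only
    rw [if_neg (by omega)]
    congr 1
    omega
  · split_ifs <;> omega

/-- Running along `P` from `a` to `b`, jumping to `c`, running on to `e`, jumping to `g` and
running on to `h`, with `h < c` and `e < a`, gives a directed path. -/
theorem IsDipathOn.three_runs {A : V → V → Prop} {N : ℕ} {P : ℕ → V} (hP : IsDipathOn A N P)
    {a b c e g h : ℕ} (hab : a ≤ b) (hbN : b ≤ N) (hce : c ≤ e) (hea : e < a)
    (hgh : g ≤ h) (hhc : h < c) (hbc : A (P b) (P c)) (heg : A (P e) (P g)) :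
    ∃ Q : ℕ → V, IsDipathOn A (b - a + 1 + (e - c) + 1 + (h - g)) Q ∧ Q 0 = P a ∧
      Q (b - a + 1 + (e - c) + 1 + (h - g)) = P h ∧
      ∀ i ≤ b - a + 1 + (e - c) + 1 + (h - g), Q i ∈ VertsUpTo N P := by
  refine ⟨fun n => P (if n ≤ b - a then a + n else
      if n ≤ b - a + 1 + (e - c) then c + (n - (b - a) - 1)
      else g + (n - (b - a + 1 + (e - c)) - 1)),
    ⟨fun i j hi hj hij => ?_, fun i hi => ?_⟩, ?_, ?_, fun i hi => ⟨_, ?_, rfl⟩⟩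
  · have := hP.1 _ _ (by split_ifs <;> omega) (by split_ifs <;> omega) hij
    split_ifs at this <;> omega
  · dsimp only
    rcases lt_trichotomy i (b - a) with hi₁ | hi₁ | hi₁
    · rw [if_pos (by omega), if_pos (by omega)]
      exact hP.2 _ (by omega)
    · rw [if_pos (by omega), if_neg (by omega), if_pos (by omega)]
      convert hbc using 2 <;> omega
    · rw [if_neg (by omega : ¬ i ≤ b - a), if_neg (by omega : ¬ i + 1 ≤ b - a)]
      rcases lt_trichotomy i (b - a + 1 + (e - c)) with hi₂ | hi₂ | hi₂
      · rw [if_pos (by omega), if_pos (by omega)]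
        convert hP.2 (c + (i - (b - a) - 1)) (by omega) using 2
        omega
      · rw [if_pos (by omega), if_neg (by omega)]
        convert heg using 2 <;> omega
      · rw [if_neg (by omega), if_neg (by omega)]
        convert hP.2 (g + (i - (b - a + 1 + (e - c)) - 1)) (by omega) using 2
        omega
  · simp
  · dsimp only
    rw [if_neg (by omega), if_neg (by omega)]
    congr 1
    omega
  · split_ifs <;> omega

/-- A shortest directed path has no arc that skips a vertex forwards. -/
theorem IsDipathOn.not_arc_of_shortest {A : V → V → Prop} {N : ℕ} {P : ℕ → V}
    (hP : IsDipathOn A N P) (hdist : ∀ m, m < N → ¬ HasDipath A m (P 0) (P N))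
    {i j : ℕ} (hij : i + 2 ≤ j) (hj : j ≤ N) : ¬ A (P i) (P j) := by
  intro harc
  refine hdist (i + 1 + (N - j)) (by omega)
    ⟨fun n => P (if n ≤ i then n else n - i - 1 + j),
      ⟨fun a b ha hb hab => ?_, fun a ha => ?_⟩, ?_, ?_⟩
  · have := hP.1 _ _ (by split_ifs <;> omega) (by split_ifs <;> omega) hab
    split_ifs at this <;> omega
  · dsimp only
    rcases lt_trichotomy a i with h | h | h
    · rw [if_pos (by omega), if_pos (by omega)]
      exact hP.2 _ (by omega)
    · rw [if_pos (by omega), if_neg (by omega)]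
      convert harc using 2
      omega
    · rw [if_neg (by omega), if_neg (by omega)]
      convert hP.2 (a - i - 1 + j) (by omega) using 2
      omega
  · simp
  · dsimp only
    rw [if_neg (by omega)]
    congr 1
    omega

/-- A vertex off a shortest directed path `P` provides no shortcut between vertices of `P` at
distance more than two. -/
theorem IsDipathOn.not_arc_arc_of_shortest {A : V → V → Prop} {N : ℕ} {P : ℕ → V}
    (hP : IsDipathOn A N P) (hdist : ∀ m, m < N → ¬ HasDipath A m (P 0) (P N))
    {x : V} (hx : x ∉ VertsUpTo N P) {t s : ℕ} (hts : t + 3 ≤ s) (hs : s ≤ N)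
    (htx : A (P t) x) : ¬ A x (P s) := by
  intro hxs
  have hne : ∀ i ≤ N, P i ≠ x := fun i hi h => hx ⟨i, hi, h⟩
  refine hdist (t + 2 + (N - s)) (by omega)
    ⟨fun n => if n ≤ t then P n else if n = t + 1 then x else P (n - t - 2 + s),
      ⟨fun a b ha hb hab => ?_, fun a ha => ?_⟩, ?_, ?_⟩
  · dsimp only at hab
    split_ifs at hab <;>
    first
      | omega
      | exact absurd hab (hne _ (by omega))
      | exact absurd hab.symm (hne _ (by omega))
      | (have := hP.1 _ _ (by omega) (by omega) hab; omega)
  · dsimp only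
    rcases lt_trichotomy a t with h | h | h
    · rw [if_pos (by omega), if_pos (by omega)]
      exact hP.2 _ (by omega)
    · rw [if_pos (by omega), if_neg (by omega), if_pos (by omega), h]
      exact htx
    · rw [if_neg (by omega : ¬ a ≤ t), if_neg (by omega : ¬ a + 1 ≤ t),
        if_neg (by omega : ¬ a + 1 = t + 1)]
      by_cases h' : a = t + 1
      · rw [if_pos h']
        convert hxs using 2
        omega
      · rw [if_neg h']
        convert hP.2 (a - t - 2 + s) (by omega) using 2
        omega
  · simp
  · dsimp only
    rw [if_neg (by omega), if_neg (by omega)]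
    congr 1
    omega

theorem IsDipathOn.cons {A : V → V → Prop} {n : ℕ} {Q : ℕ → V} (hQ : IsDipathOn A n Q)
    {x : V} (hx : ∀ i ≤ n, Q i ≠ x) (hxQ : A x (Q 0)) :
    IsDipathOn A (n + 1) (fun i => if i = 0 then x else Q (i - 1)) := by
  refine ⟨fun i j hi hj hij => ?_, fun i hi => ?_⟩
  · dsimp only at hij
    split_ifs at hij <;>
    first
      | omega
      | exact absurd hij (hx _ (by omega))
      | exact absurd hij.symm (hx _ (by omega))
      | (have := hQ.1 _ _ (by omega) (by omega) hij; omega)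
  · dsimp only
    rw [if_neg (by omega : ¬ i + 1 = 0)]
    by_cases h : i = 0
    · subst h
      simpa using hxQ
    · rw [if_neg h]
      convert hQ.2 (i - 1) (by omega) using 2
      omega

theorem IsDipathOn.concat {A : V → V → Prop} {n : ℕ} {Q : ℕ → V} (hQ : IsDipathOn A n Q)
    {x : V} (hx : ∀ i ≤ n, Q i ≠ x) (hQx : A (Q n) x) :
    IsDipathOn A (n + 1) (fun i => if i ≤ n then Q i else x) := by
  refine ⟨fun i j hi hj hij => ?_, fun i hi => ?_⟩
  · dsimp only at hij
    split_ifs at hij <;>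
    first
      | omega
      | exact absurd hij (hx _ (by omega))
      | exact absurd hij.symm (hx _ (by omega))
      | exact hQ.1 _ _ (by omega) (by omega) hij
  · dsimp only
    rw [if_pos (by omega)]
    by_cases h : i = n
    · rw [if_neg (by omega), h]
      exact hQx
    · rw [if_pos (by omega)]
      exact hQ.2 _ (by omega)

section ShortestPath

variable {A : V → V → Prop} {k : ℕ} {P : ℕ → V}

/-- Along a shortest path, the ends of a directed path of length `k` are joined by an arc
directed backwards. -/
theorem KQuasiTransitive.arc_of_shortest (hQT : KQuasiTransitive A k) {N : ℕ}
    (hP : IsDipathOn A N P) (hdist : ∀ m, m < N → ¬ HasDipath A m (P 0) (P N))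
    {i j : ℕ} (hij : i + 2 ≤ j) (hj : j ≤ N)
    (hpath : HasDipath A k (P i) (P j) ∨ HasDipath A k (P j) (P i)) : A (P j) (P i) := by
  have hno := hP.not_arc_of_shortest hdist hij hj
  rcases hpath with ⟨Q, hQ, h0, hk⟩ | ⟨Q, hQ, h0, hk⟩ <;>
    · have h := hQT Q hQ
      rw [h0, hk] at h
      unfold DAdj at h
      tauto

theorem KQuasiTransitive.arc_add (hQT : KQuasiTransitive A k) (hk : 2 ≤ k) {N : ℕ}
    (hP : IsDipathOn A N P) (hdist : ∀ m, m < N → ¬ HasDipath A m (P 0) (P N))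
    {i : ℕ} (hi : i + k ≤ N) : A (P (i + k)) (P i) := by
  refine hQT.arc_of_shortest hP hdist (by omega) hi
    (Or.inl ⟨fun n => P (i + n), ⟨?_, ?_⟩, rfl, rfl⟩)
  · intro a b ha hb hab
    have := hP.1 _ _ (by omega) (by omega) hab
    omega
  · intro a ha
    exact hP.2 (i + a) (by omega)

theorem KQuasiTransitive.arc_last_first (hQT : KQuasiTransitive A k) (hk : 3 ≤ k)
    (hP : IsDipathOn A (k + 2) P)
    (hdist : ∀ m, m < k + 2 → ¬ HasDipath A m (P 0) (P (k + 2))) :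
    A (P (k + 2)) (P 0) := by
  have hk0 : A (P k) (P 0) := by
    simpa using hQT.arc_add (by omega) hP hdist (i := 0) (by omega)
  have hk2 : A (P (k + 2)) (P 2) := by
    simpa [add_comm] using hQT.arc_add (by omega) hP hdist (i := 2) (by omega)
  obtain ⟨Q, hQ, h0, hl, -⟩ := hP.three_runs (a := k + 2) (b := k + 2) (c := 2) (e := k)
    (g := 0) (h := 0) le_rfl le_rfl (by omega) (by omega) le_rfl (by omega) hk2 hk0
  rw [show k + 2 - (k + 2) + 1 + (k - 2) + 1 + (0 - 0) = k by omega] at hQ hl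
  exact hQT.arc_of_shortest hP hdist (by omega) le_rfl (Or.inr ⟨Q, hQ, h0, hl⟩)

/-- The last vertex of the path dominates all vertices of the opposite parity, except possibly
its predecessor. -/
theorem KQuasiTransitive.arc_last_even (hQT : KQuasiTransitive A k) (hk : 3 ≤ k)
    (hP : IsDipathOn A (k + 2) P)
    (hdist : ∀ m, m < k + 2 → ¬ HasDipath A m (P 0) (P (k + 2))) (i : ℕ)
    (hi : 2 * i + 1 ≤ k) : A (P (k + 2)) (P (k - 1 - 2 * i)) := by
  have hk0 : A (P k) (P 0) := by
    simpa using hQT.arc_add (by omega) hP hdist (i := 0) (by omega)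
  induction i with
  | zero =>
    obtain ⟨Q, hQ, h0, hl, -⟩ := hP.two_runs (a := k + 2) (b := k + 2) (c := 0) (e := k - 1)
      le_rfl le_rfl (by omega) (by omega) (hQT.arc_last_first hk hP hdist)
    rw [show k + 2 - (k + 2) + 1 + (k - 1 - 0) = k by omega] at hQ hl
    exact hQT.arc_of_shortest hP hdist (by omega) le_rfl (Or.inr ⟨Q, hQ, h0, hl⟩)
  | succ i ih =>
    obtain ⟨Q, hQ, h0, hl, -⟩ := hP.three_runs (a := k + 2) (b := k + 2) (c := k - 1 - 2 * i)
      (e := k) (g := 0) (h := k - 1 - 2 * (i + 1)) le_rfl le_rfl (by omega) (by omega)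
      (by omega) (by omega) (ih (by omega)) hk0
    rw [show k + 2 - (k + 2) + 1 + (k - (k - 1 - 2 * i)) + 1 + (k - 1 - 2 * (i + 1) - 0) = k
      by omega] at hQ hl
    exact hQT.arc_of_shortest hP hdist (by omega) le_rfl (Or.inr ⟨Q, hQ, h0, hl⟩)

/-- The first vertex of the path is dominated by all odd vertices, except possibly its
successor. -/
theorem KQuasiTransitive.arc_odd_first (hQT : KQuasiTransitive A k) (hk : 3 ≤ k)
    (hP : IsDipathOn A (k + 2) P)
    (hdist : ∀ m, m < k + 2 → ¬ HasDipath A m (P 0) (P (k + 2))) (i : ℕ)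
    (hi : 2 * i + 3 ≤ k + 2) : A (P (2 * i + 3)) (P 0) := by
  have hk2 : A (P (k + 2)) (P 2) := by
    simpa [add_comm] using hQT.arc_add (by omega) hP hdist (i := 2) (by omega)
  induction i with
  | zero =>
    obtain ⟨Q, hQ, h0, hl, -⟩ := hP.two_runs (a := 3) (b := k + 2) (c := 0) (e := 0)
      (by omega) le_rfl (by omega) (by omega) (hQT.arc_last_first hk hP hdist)
    rw [show k + 2 - 3 + 1 + (0 - 0) = k by omega] at hQ hl
    exact hQT.arc_of_shortest hP hdist (by omega) hi (Or.inr ⟨Q, hQ, h0, hl⟩)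
  | succ i ih =>
    obtain ⟨Q, hQ, h0, hl, -⟩ := hP.three_runs (a := 2 * (i + 1) + 3) (b := k + 2) (c := 2)
      (e := 2 * i + 3) (g := 0) (h := 0) (by omega) le_rfl (by omega) (by omega)
      (by omega) (by omega) hk2 (ih (by omega))
    rw [show k + 2 - (2 * (i + 1) + 3) + 1 + (2 * i + 3 - 2) + 1 + (0 - 0) = k
      by omega] at hQ hl
    exact hQT.arc_of_shortest hP hdist (by omega) hi (Or.inr ⟨Q, hQ, h0, hl⟩)

/-- Two vertices of the same parity are joined, backwards, by a directed path of length `k - 1`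
within the vertices of the shortest path. -/
theorem KQuasiTransitive.exists_backward_path (hQT : KQuasiTransitive A k) (hk : 5 ≤ k)
    (hkodd : Odd k) (hP : IsDipathOn A (k + 2) P)
    (hdist : ∀ m, m < k + 2 → ¬ HasDipath A m (P 0) (P (k + 2)))
    {s t : ℕ} (hts : t < s) (hs : s ≤ k + 2) (hpar : s % 2 = t % 2) :
    ∃ Q : ℕ → V, IsDipathOn A (k - 1) Q ∧ Q 0 = P s ∧ Q (k - 1) = P t ∧
      ∀ i ≤ k - 1, Q i ∈ VertsUpTo (k + 2) P := by
  have hk3 : 3 ≤ k := by omega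
  obtain ⟨r, hr⟩ := hkodd
  obtain h | h | h : s = t + 2 ∨ s = t + 4 ∨ t + 6 ≤ s := by omega
  · rcases le_or_gt 2 t with ht | ht
    · have hk2 : A (P (k + 2)) (P 2) := by
        simpa [add_comm] using hQT.arc_add (by omega) hP hdist (i := 2) (by omega)
      have := hP.two_runs (a := s) (b := k + 2) (c := 2) (e := t) hs le_rfl ht hts hk2
      rwa [show k + 2 - s + 1 + (t - 2) = k - 1 by omega] at this
    · have hk0 : A (P k) (P 0) := by
        simpa using hQT.arc_add (by omega) hP hdist (i := 0) (by omega)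
      have := hP.two_runs (a := s) (b := k) (c := 0) (e := t) (by omega) (by omega)
        (by omega) hts hk0
      rwa [show k - s + 1 + (t - 0) = k - 1 by omega] at this
  · have := hP.two_runs (a := s) (b := k + 2) (c := 0) (e := t) hs le_rfl (by omega) hts
      (hQT.arc_last_first hk3 hP hdist)
    rwa [show k + 2 - s + 1 + (t - 0) = k - 1 by omega] at this
  · obtain ⟨c, htc, hct, hc⟩ : ∃ c, t < c ∧ c ≤ t + 2 ∧ c % 2 = 0 :=
      ⟨2 * (t / 2) + 2, by omega, by omega, by omega⟩
    have hlast := hQT.arc_last_even hk3 hP hdist ((k - 1 - c) / 2) (by omega)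
    rw [show k - 1 - 2 * ((k - 1 - c) / 2) = c by omega] at hlast
    have hfirst := hQT.arc_odd_first hk3 hP hdist ((c + (s - t) - 5 - 3) / 2) (by omega)
    rw [show 2 * ((c + (s - t) - 5 - 3) / 2) + 3 = c + (s - t) - 5 by omega] at hfirst
    have := hP.three_runs (a := s) (b := k + 2) (c := c) (e := c + (s - t) - 5) (g := 0) (h := t)
      hs le_rfl (by omega) (by omega) (by omega) htc hlast hfirst
    rwa [show k + 2 - s + 1 + (c + (s - t) - 5 - c) + 1 + (t - 0) = k - 1 by omega] at this

end ShortestPath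

theorem stmt_3
    {V : Type*} [Fintype V] (A : V → V → Prop) (hirr : Irreflexive A)
    (k : ℕ) (hk5 : 5 ≤ k) (hkodd : Odd k)
    (hQT : KQuasiTransitive A k) (hstrong : StrongD A)
    (u v : V) (hdist : ∀ m, m < k + 2 → ¬ HasDipath A m u v)
    (P : ℕ → V) (hP : IsDipathOn A (k + 2) P) (hPu : P 0 = u) (hPv : P (k + 2) = v) :
    ∀ s t : ℕ, t < s → s ≤ k + 2 → s % 2 = t % 2 →
      (∃ Q : ℕ → V, IsDipathOn A (k - 1) Q ∧ Q 0 = P s ∧ Q (k - 1) = P t ∧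
        ∀ i ≤ k - 1, Q i ∈ VertsUpTo (k + 2) P) ∧
      (∀ x : V, x ∉ VertsUpTo (k + 2) P →
        (A x (P s) → DAdj A x (P t) ∧ (t + 4 ≤ s → A x (P t))) ∧
        (A (P t) x → DAdj A x (P s) ∧ (t + 4 ≤ s → A (P s) x))) := by
  intro s t hts hs hpar
  subst hPu hPv
  obtain ⟨Q, hQ, h0, hl, hV⟩ :=
    hQT.exists_backward_path hk5 hkodd hP hdist hts hs hpar
  refine ⟨⟨Q, hQ, h0, hl, hV⟩, fun x hx => ?_⟩
  have hne : ∀ i ≤ k - 1, Q i ≠ x := fun i hi h => hx (h ▸ hV i hi)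
  have hk : k - 1 + 1 = k := by omega
  have hno : t + 4 ≤ s → A (P t) x → ¬ A x (P s) := fun h =>
    hP.not_arc_arc_of_shortest hdist hx (by omega) hs
  constructor <;> intro hxP
  · have hpath := hQ.cons hne (h0 ▸ hxP)
    rw [hk] at hpath
    have hadj := hQT _ hpath
    simp only [if_true, if_neg (show k ≠ 0 by omega), hl] at hadj
    exact ⟨hadj, fun h => hadj.resolve_right fun h' => hno h h' hxP⟩
  · have hpath := hQ.concat hne (hl ▸ hxP)
    rw [hk] at hpath
    have hadj := hQT _ hpath
    simp only [if_pos (Nat.zero_le _), if_neg (show ¬ k ≤ k - 1 by omega), h0] at hadj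
    exact ⟨hadj.symm, fun h => hadj.resolve_right fun h' => hno h hxP h'⟩
end

section
/- Let H be a digraph, let u, v be vertices of H with d(u,v) = n where n ≥ 4, and let Q = x_0 x_1 … x_n be a shortest directed (u,v)-path in H. If the induced subdigraph H[V(Q)] is semicomplete, then for any indices 0 ≤ i < j ≤ n and any integer p with 2 ≤ p ≤ n−1, there exists a directed path of length p from x_j to x_i all of whose vertices lie in V(Q). -/
variable {V : Type*}

/-- A shortest path has no forward chord. -/
lemma IsDipathOn.not_forward_chord {V : Type*} {A : V → V → Prop} {n : ℕ} {Q : ℕ → V}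
    (hQ : IsDipathOn A n Q) (hdist : ∀ m, m < n → ¬ HasDipath A m (Q 0) (Q n))
    {k l : ℕ} (hkl : k + 2 ≤ l) (hl : l ≤ n) : ¬ A (Q k) (Q l) := by
  intro h
  refine hdist (n - (l - k - 1)) (by omega)
    ⟨fun m => Q (if m ≤ k then m else m + (l - k - 1)), ⟨?_, ?_⟩, by simp, ?_⟩
  · intro a b ha hb hab
    have := hQ.1 _ _ (by split_ifs <;> omega) (by split_ifs <;> omega) hab
    split_ifs at this <;> omega
  · intro m hm
    rcases lt_trichotomy m k with hmk | rfl | hmk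
    · simpa [hmk.le, Nat.succ_le_of_lt hmk] using hQ.2 m (by omega)
    · have e : m + 1 + (l - m - 1) = l := by omega
      simpa [e] using h
    · have e : m + 1 + (l - k - 1) = m + (l - k - 1) + 1 := by omega
      have h1 : ¬ m ≤ k := by omega
      have h2 : ¬ m + 1 ≤ k := by omega
      simp only [h1, h2, if_false, e]
      exact hQ.2 _ (by omega)
  · have h1 : ¬ n - (l - k - 1) ≤ k := by omega
    simp only [h1, if_false]
    congr 1
    omega

/-- `f` lists a path of length `p` from `j` to `i` inside the interval `[a, b]`, in the digraph
on `ℕ` whose arcs go one step up, or at least two steps down. -/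
def IsIndexPath (a b p j i : ℕ) (f : ℕ → ℕ) : Prop :=
  f 0 = j ∧ f p = i ∧ (∀ k ≤ p, a ≤ f k ∧ f k ≤ b) ∧
    (∀ k l, k ≤ p → l ≤ p → f k = f l → k = l) ∧
    ∀ k < p, f (k + 1) = f k + 1 ∨ f (k + 1) + 2 ≤ f k

/-- In an interval with `p + 2 ≥ 5` elements there are paths omitting exactly one vertex from
each element to each smaller one. -/
lemma exists_isIndexPath_interval {a p i j : ℕ} (hp : 3 ≤ p) (hai : a ≤ i) (hij : i < j)
    (hj : j ≤ a + p + 1) : ∃ f, IsIndexPath a (a + p + 1) p j i f := by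
  unfold IsIndexPath
  by_cases h₁ : j = i + 1
  · by_cases h₂ : j < a + p + 1
    · refine ⟨fun k => if k < a + p + 1 - j then j + k else a + (k - (a + p + 1 - j)),
        ?_, ?_, ?_, ?_, ?_⟩ <;> grind
    · refine ⟨fun k => if k = 0 then j else a + k, ?_, ?_, ?_, ?_, ?_⟩ <;> grind
  by_cases h₃ : j = i + 2
  · refine ⟨fun k => if k < a + p + 2 - j then j + k else a + (k - (a + p + 2 - j)),
      ?_, ?_, ?_, ?_, ?_⟩ <;> grind
  by_cases h₄ : i + 4 ≤ a + p + 1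
  · refine ⟨fun k => if k < a + p + 2 - j then j + k else
      if k < a + p - i then i + 2 + (k - (a + p + 2 - j)) else a + (k - (a + p - i)),
      ?_, ?_, ?_, ?_, ?_⟩ <;> grind
  · refine ⟨fun k => if k = 0 then j else if k = 1 then j - 2 else a + (k - 2),
      ?_, ?_, ?_, ?_, ?_⟩ <;> grind

lemma exists_isIndexPath {n p i j : ℕ} (hn : 4 ≤ n) (hij : i < j) (hj : j ≤ n) (hp : 2 ≤ p)
    (hpn : p + 1 ≤ n) : ∃ f, IsIndexPath 0 n p j i f := by
  by_cases hfar : p + 1 < j - i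
  · refine ⟨fun k => if k = 0 then j else if k < p then j - p + (k - 1) else i, ?_⟩
    unfold IsIndexPath
    refine ⟨?_, ?_, ?_, ?_, ?_⟩ <;> grind
  by_cases hp3 : 3 ≤ p
  · obtain ⟨f, h0, h1, h2, h3⟩ :=
      exists_isIndexPath_interval (a := min i (n - p - 1)) hp3 (by omega) hij (by omega)
    exact ⟨f, h0, h1, fun k hk => by have := h2 k hk; omega, h3⟩
  obtain rfl : p = 2 := by omega
  unfold IsIndexPath
  by_cases hjn : j < n
  · refine ⟨fun k => if k = 0 then j else if k = 1 then j + 1 else i, ?_, ?_, ?_, ?_, ?_⟩ <;> grind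
  · refine ⟨fun k => if k = 0 then j else if k = 1 then i - 1 else i, ?_, ?_, ?_, ?_, ?_⟩ <;> grind

theorem stmt_6
    {V : Type*} [Fintype V] (A : V → V → Prop) (hirr : Irreflexive A)
    (n : ℕ) (hn : 4 ≤ n) (u v : V)
    (hdist : ∀ m, m < n → ¬ HasDipath A m u v)
    (Q : ℕ → V) (hQ : IsDipathOn A n Q) (hQu : Q 0 = u) (hQv : Q n = v)
    (hsemi : SemicompleteOn A (VertsUpTo n Q)) :
    ∀ i j : ℕ, i < j → j ≤ n → ∀ p : ℕ, 2 ≤ p → p ≤ n - 1 →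
      ∃ R : ℕ → V, IsDipathOn A p R ∧ R 0 = Q j ∧ R p = Q i ∧
        ∀ m ≤ p, R m ∈ VertsUpTo n Q := by
  intro i j hij hj p hp hpn
  subst hQu hQv
  obtain ⟨f, h0, hlast, hmem, hinj, hstep⟩ :=
    exists_isIndexPath (n := n) hn hij hj hp (by omega)
  refine ⟨fun k => Q (f k), ⟨?_, ?_⟩, by simp [h0], by simp [hlast],
    fun m hm => ⟨f m, (hmem m hm).2, rfl⟩⟩
  · intro k l hk hl h
    exact hinj k l hk hl (hQ.1 _ _ (hmem k hk).2 (hmem l hl).2 h)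
  · intro k hk
    have hk' := (hmem k hk.le).2
    have hk1 := (hmem (k + 1) hk).2
    rcases hstep k hk with h | h
    · simpa only [h] using hQ.2 (f k) (by omega)
    · refine (hsemi _ ⟨f k, hk', rfl⟩ _ ⟨f (k + 1), hk1, rfl⟩ fun e => ?_).resolve_right
        (hQ.not_forward_chord hdist h hk')
      have := hQ.1 _ _ hk' hk1 e
      omega
end

section
/- Let x ∈ I. If there exists a vertex x_i ∈ E(P) with x→x_i, then x ↦ E(P); if there exists a vertex x_i ∈ O(P) with x→x_i, then x ↦ O(P). -/
variable {V : Type*}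

/-- A segment of length `k` on a shortest path of length `k + 2` closes up to a directed cycle. -/
theorem arc_back_of_shortest {V : Type*} {A : V → V → Prop} {k : ℕ} (hk : 2 ≤ k)
    (hQT : KQuasiTransitive A k) {P : ℕ → V} (hP : IsDipathOn A (k + 2) P)
    (hdist : ∀ m, m < k + 2 → ¬ HasDipath A m (P 0) (P (k + 2))) {l : ℕ} (hl : l ≤ 2) :
    A (P (l + k)) (P l) := by
  have hadj := hQT (fun t => P (l + t))
    ⟨fun i j hi hj h => by have := hP.1 _ _ (by omega) (by omega) h; omega,
      fun i hi => hP.2 (l + i) (by omega)⟩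
  rcases hadj with h | h
  · refine absurd ⟨fun t => P (if t ≤ l then t else t + k - 1), ⟨?_, ?_⟩, ?_, ?_⟩
      (hdist 3 (by omega))
    · intro i j hi hj hij
      have := hP.1 _ _ (by split_ifs <;> omega) (by split_ifs <;> omega) hij
      split_ifs at this <;> omega
    · intro i hi
      rcases lt_trichotomy i l with hil | rfl | hil
      · simpa [hil.le, Nat.succ_le_of_lt hil] using hP.2 i (by omega)
      · have e : i + 1 + k - 1 = i + k := by omega
        simpa [e] using h
      · have e : i + 1 + k - 1 = i + k - 1 + 1 := by omega
        simpa [not_le.2 hil, not_le.2 (Nat.lt_succ_of_lt hil), e] using hP.2 (i + k - 1) (by omega)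
    · simp
    · have e : 3 + k - 1 = k + 2 := by omega
      simp [show ¬ 3 ≤ l by omega, e]
  · exact h

/-- Prepending an in-neighbour to a path of length `k - 1` gives an arc to its last vertex,
provided the converse arc is absent. -/
theorem arc_of_cons_dipath {V : Type*} {A : V → V → Prop} {n : ℕ}
    (hQT : KQuasiTransitive A (n + 1)) {x : V} {Q : ℕ → V} (hQ : IsDipathOn A n Q)
    (hx : ∀ i ≤ n, x ≠ Q i) (hxQ : A x (Q 0)) (hn : ¬ A (Q n) x) : A x (Q n) := by
  have hadj := hQT (fun t => Nat.casesOn t x Q) ⟨?_, ?_⟩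
  · exact hadj.resolve_right hn
  · rintro (_ | i) (_ | j) hi hj h
    · rfl
    · exact absurd h (hx j (by omega))
    · exact absurd h.symm (hx i (by omega))
    · rw [hQ.1 i j (by omega) (by omega) h]
  · rintro (_ | i) hi
    · exact hxQ
    · exact hQ.2 i (by omega)

/-- For a vertex without in-neighbours on the path, out-neighbours shift forward by `k - 1`. -/
theorem arc_shift_forward {V : Type*} {A : V → V → Prop} {n : ℕ}
    (hQT : KQuasiTransitive A (n + 1)) {P : ℕ → V} (hP : IsDipathOn A (n + 3) P) {x : V}
    (hx : x ∈ ISet A (VertsUpTo (n + 3) P)) {i : ℕ} (hi : i ≤ 3) (h : A x (P i)) :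
    A x (P (i + n)) := by
  refine arc_of_cons_dipath hQT (Q := fun t => P (i + t)) ⟨?_, ?_⟩ ?_ h
    (hx.2 _ ⟨i + n, by omega, rfl⟩)
  · intro a b ha hb hab
    have := hP.1 _ _ (by omega) (by omega) hab
    omega
  · exact fun a ha => hP.2 (i + a) (by omega)
  · exact fun a ha e => hx.1 ⟨i + a, by omega, e.symm⟩

/-- For a vertex without in-neighbours on a shortest path, out-neighbours shift back by two. -/
theorem arc_shift_back {V : Type*} {A : V → V → Prop} {n : ℕ} (hn : 1 ≤ n)
    (hQT : KQuasiTransitive A (n + 1)) {P : ℕ → V} (hP : IsDipathOn A (n + 3) P)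
    (hdist : ∀ m, m < n + 3 → ¬ HasDipath A m (P 0) (P (n + 3))) {x : V}
    (hx : x ∈ ISet A (VertsUpTo (n + 3) P)) {i : ℕ} (hi : i + 2 ≤ n + 3) (h : A x (P (i + 2))) :
    A x (P i) := by
  obtain ⟨l, hl, hli, hil⟩ : ∃ l ≤ 2, l ≤ i ∧ i + 2 ≤ l + (n + 1) :=
    ⟨i + 2 - (n + 1), by omega, by omega, by omega⟩
  have hback := arc_back_of_shortest (by omega) hQT hP hdist hl
  -- walk from `i + 2` up to `l + n + 1`, jump back to `l`, and walk up to `i`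
  have key := arc_of_cons_dipath hQT
    (Q := fun t => P (if i + 2 + t ≤ l + (n + 1) then i + 2 + t else t + i - n)) (x := x)
    ⟨?_, ?_⟩ ?_ (by simpa [hil] using h) ?_
  · have e : ¬ i + 2 + n ≤ l + (n + 1) := by omega
    simpa [e] using key
  · intro a b ha hb hab
    have := hP.1 _ _ (by split_ifs <;> omega) (by split_ifs <;> omega) hab
    split_ifs at this <;> omega
  · intro a ha
    rcases lt_trichotomy (i + 2 + a) (l + (n + 1)) with hlt | heq | hgt
    · have e' : i + 2 + (a + 1) ≤ l + (n + 1) := by omega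
      simp only [hlt.le, e', if_true]
      exact hP.2 (i + 2 + a) (by omega)
    · have e : a + 1 + i - n = l := by omega
      have e' : ¬ i + 2 + (a + 1) ≤ l + (n + 1) := by omega
      simpa only [heq, le_refl, if_true, e', if_false, e] using hback
    · have e : a + 1 + i - n = a + i - n + 1 := by omega
      have e' : ¬ i + 2 + (a + 1) ≤ l + (n + 1) := by omega
      simpa only [not_le.2 hgt, e', if_false, e] using hP.2 (a + i - n) (by omega)
  · exact fun a ha e => hx.1 ⟨_, by split_ifs <;> omega, e.symm⟩
  · exact hx.2 _ ⟨_, by split_ifs <;> omega, rfl⟩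

/-- A vertex without in-neighbours on a shortest path that dominates some vertex of the path
dominates every vertex of the same parity. -/
theorem arc_of_same_parity {V : Type*} {A : V → V → Prop} {n : ℕ} (hn : 4 ≤ n) (hne : Even n)
    (hQT : KQuasiTransitive A (n + 1)) {P : ℕ → V} (hP : IsDipathOn A (n + 3) P)
    (hdist : ∀ m, m < n + 3 → ¬ HasDipath A m (P 0) (P (n + 3))) {x : V}
    (hx : x ∈ ISet A (VertsUpTo (n + 3) P)) {i j : ℕ} (hi : i ≤ n + 3) (hj : j ≤ n + 3)
    (hij : i % 2 = j % 2) (h : A x (P i)) : A x (P j) := by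
  have down : ∀ d a, a + 2 * d ≤ n + 3 → A x (P (a + 2 * d)) → A x (P a) := by
    intro d
    induction d with
    | zero => exact fun a _ h => h
    | succ d ih =>
      exact fun a ha h => ih a (by omega)
        (arc_shift_back (by omega) hQT hP hdist hx (by omega) h)
  have descend : ∀ a b, b ≤ n + 3 → a ≤ b → a % 2 = b % 2 → A x (P b) → A x (P a) := by
    intro a b hb hab hpar h
    obtain ⟨d, rfl⟩ : ∃ d, b = a + 2 * d := ⟨(b - a) / 2, by omega⟩
    exact down d a hb h
  have hn2 : n % 2 = 0 := Nat.even_iff.1 hne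
  have h0 := descend (i % 2) i hi (by omega) (by omega) h
  have h1 := arc_shift_forward hQT hP hx (by omega) h0
  have h2 := descend (i % 2 + 2) _ (by omega) (by omega) (by omega) h1
  have h3 := arc_shift_forward hQT hP hx (by omega) h2
  exact descend j _ (by omega) (by omega) (by omega) h3

theorem stmt_8
    {V : Type*} [Fintype V] (A : V → V → Prop) (hirr : Irreflexive A)
    (k : ℕ) (hk5 : 5 ≤ k) (hkodd : Odd k)
    (hQT : KQuasiTransitive A k) (hstrong : StrongD A)
    (u v : V) (hdist : ∀ m, m < k + 2 → ¬ HasDipath A m u v)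
    (P : ℕ → V) (hP : IsDipathOn A (k + 2) P) (hPu : P 0 = u) (hPv : P (k + 2) = v) :
    ∀ x ∈ ISet A (VertsUpTo (k + 2) P),
      ((∃ i, i ≤ k + 2 ∧ Even i ∧ A x (P i)) →
        (∀ w ∈ EvenVertsUpTo (k + 2) P, A x w) ∧
        (∀ w ∈ EvenVertsUpTo (k + 2) P, ¬ A w x)) ∧
      ((∃ i, i ≤ k + 2 ∧ Odd i ∧ A x (P i)) →
        (∀ w ∈ OddVertsUpTo (k + 2) P, A x w) ∧
        (∀ w ∈ OddVertsUpTo (k + 2) P, ¬ A w x)) := by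
  subst hPu hPv
  obtain ⟨n, rfl⟩ : ∃ n, k = n + 1 := ⟨k - 1, by omega⟩
  have hne : Even n := by
    rw [Nat.odd_iff] at hkodd
    rw [Nat.even_iff]
    omega
  intro x hx
  refine ⟨?_, ?_⟩
  · rintro ⟨i, hi, hpi, h⟩
    refine ⟨?_, ?_⟩
    · rintro w ⟨j, hj, hpj, rfl⟩
      exact arc_of_same_parity (by omega) hne hQT hP hdist hx hi hj
        ((Nat.even_iff.1 hpi).trans (Nat.even_iff.1 hpj).symm) h
    · rintro w ⟨j, hj, -, rfl⟩
      exact hx.2 _ ⟨j, hj, rfl⟩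
  · rintro ⟨i, hi, hpi, h⟩
    refine ⟨?_, ?_⟩
    · rintro w ⟨j, hj, hpj, rfl⟩
      exact arc_of_same_parity (by omega) hne hQT hP hdist hx hi hj
        ((Nat.odd_iff.1 hpi).trans (Nat.odd_iff.1 hpj).symm) h
    · rintro w ⟨j, hj, -, rfl⟩
      exact hx.2 _ ⟨j, hj, rfl⟩
end
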